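/- For r > 0 let Q_r := ([−r, r] ∩ ℤ)³ ⊂ ℤ³. There exists a constant p > 3/2 such that the following holds: for each K > 0 there is C₁ > 0 such that for every large enough n ∈ ℤ₊ and all functions u, q : ℤ³ → ℝ with Δ_d u(x) = q(x) u(x) for every x ∈ Q_n and ‖q‖_∞ ≤ K, the number of points a ∈ Q_n with |u(a)| ≥ exp(−C₁ n) |u(0)| is at least n^p. -/

import Mathlib

open Real

/-- The discrete Laplacian on `ℤ³`: `Δ_d u(x) = ∑_{|y−x|=1} (u(y) − u(x))`, the sum
running over the six nearest neighbors of `x`. -/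
def discreteLaplacian3 (u : (Fin 3 → ℤ) → ℝ) (x : Fin 3 → ℤ) : ℝ :=
  ∑ i : Fin 3,
    (u (Function.update x i (x i + 1)) + u (Function.update x i (x i - 1)) - 2 * u x)

/-- The cube `Q_r = ([−r, r] ∩ ℤ)³ ⊂ ℤ³`. -/
def latticeCube (r : ℕ) : Set (Fin 3 → ℤ) :=
  {a | ∀ i, |a i| ≤ (r : ℤ)}

/-- Lagrange interpolation at integer nodes: a polynomial of degree less than the number of nodes
is controlled on all of `{0, …, n}` by its values at the nodes. -/
lemma abs_eval_le_of_nodes (P : Polynomial ℝ) (Y : Finset ℕ) (n : ℕ) (hY : ∀ y ∈ Y, y ≤ n)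
    (hdeg : P.degree < Y.card) (B : ℝ) (h : ∀ y ∈ Y, |P.eval (y : ℝ)| ≤ B)
    (x : ℕ) (hx : x ≤ n) :
    |P.eval (x : ℝ)| ≤ Y.card * ((n + 1 : ℝ) ^ Y.card * B) := by
  have hinj : Set.InjOn (fun i : ℕ => (i : ℝ)) (Y : Set ℕ) :=
    fun a _ b _ hab => by simpa using hab
  have key := Lagrange.eq_interpolate (s := Y) (v := fun i : ℕ => (i : ℝ)) hinj hdeg
  rw [key, Lagrange.interpolate_apply, Polynomial.eval_finsetSum]
  have hterm : ∀ i ∈ Y, |Polynomial.eval (x : ℝ) (Polynomial.C (Polynomial.eval (i : ℝ) P) *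
      Lagrange.basis Y (fun i : ℕ => (i : ℝ)) i)| ≤ (n + 1 : ℝ) ^ Y.card * B := by
    intro i hi
    rw [Polynomial.eval_mul, Polynomial.eval_C, abs_mul, mul_comm]
    refine mul_le_mul ?_ (h i hi) (abs_nonneg _) (by positivity)
    rw [Lagrange.basis, Polynomial.eval_prod, Finset.abs_prod]
    calc ∏ j ∈ Y.erase i, |Polynomial.eval (x : ℝ) (Lagrange.basisDivisor (i : ℝ) (j : ℝ))|
        ≤ ∏ j ∈ Y.erase i, (n + 1 : ℝ) := by
          refine Finset.prod_le_prod (fun _ _ => abs_nonneg _) ?_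
          intro j hj
          have hji : j ≠ i := (Finset.mem_erase.mp hj).1
          have hjn : j ≤ n := hY j (Finset.mem_erase.mp hj).2
          rw [Lagrange.basisDivisor]
          simp only [Polynomial.eval_mul, Polynomial.eval_C, Polynomial.eval_sub,
            Polynomial.eval_X, abs_mul, abs_inv]
          have h1 : (1 : ℝ) ≤ |(i : ℝ) - j| := by
            have : (1 : ℤ) ≤ |(i : ℤ) - j| := Int.one_le_abs (by omega)
            exact_mod_cast this
          have h2 : |(x : ℝ) - j| ≤ n + 1 := by
            have : |(x : ℤ) - j| ≤ n + 1 := by rw [abs_le]; omega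
            exact_mod_cast this
          have h3 : |(i : ℝ) - j|⁻¹ ≤ 1 := inv_le_one_of_one_le₀ h1
          calc |(i : ℝ) - j|⁻¹ * |(x : ℝ) - j| ≤ 1 * (n + 1) :=
                mul_le_mul h3 h2 (abs_nonneg _) zero_le_one
            _ = _ := one_mul _
      _ = (n + 1 : ℝ) ^ (Y.erase i).card := by simp
      _ ≤ (n + 1 : ℝ) ^ Y.card := by
          apply pow_le_pow_right₀ (by linarith [n.cast_nonneg (α := ℝ)])
          exact Finset.card_le_card (Finset.erase_subset _ _)
  calc _ ≤ ∑ i ∈ Y, |Polynomial.eval (x : ℝ) (Polynomial.C (Polynomial.eval (i : ℝ) P) *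
      Lagrange.basis Y (fun i : ℕ => (i : ℝ)) i)| := Finset.abs_sum_le_sum_abs _ _
    _ ≤ ∑ i ∈ Y, (n + 1 : ℝ) ^ Y.card * B := Finset.sum_le_sum hterm
    _ = _ := by simp

/-- The polynomial `∑ l < k, a (k - l) * (X choose l)`. -/
noncomputable def newtonPoly (a : ℕ → ℝ) (k : ℕ) : Polynomial ℝ :=
  ∑ l ∈ Finset.range k, Polynomial.C (a (k - l) / (l.factorial : ℝ)) * descPochhammer ℝ l

lemma newtonPoly_eval (a : ℕ → ℝ) (k j : ℕ) :
    (newtonPoly a k).eval (j : ℝ) = ∑ l ∈ Finset.range k, a (k - l) * (j.choose l : ℝ) := by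
  rw [newtonPoly, Polynomial.eval_finsetSum]
  refine Finset.sum_congr rfl fun l _ => ?_
  rw [Polynomial.eval_mul, Polynomial.eval_C, descPochhammer_eval_eq_descFactorial,
    Nat.descFactorial_eq_factorial_mul_choose]
  have : (l.factorial : ℝ) ≠ 0 := by positivity
  push_cast
  field_simp

lemma newtonPoly_degree_lt (a : ℕ → ℝ) (k : ℕ) : (newtonPoly a k).degree < (k : WithBot ℕ) := by
  rw [newtonPoly, ← Polynomial.mem_degreeLT]
  refine Submodule.sum_mem _ fun l hl => ?_
  rw [Polynomial.mem_degreeLT]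
  refine lt_of_le_of_lt Polynomial.degree_le_natDegree ?_
  have hle := Polynomial.natDegree_C_mul_le (a (k - l) / (l.factorial : ℝ)) (descPochhammer ℝ l)
  rw [descPochhammer_natDegree] at hle
  have hlt := hle.trans_lt (Finset.mem_range.mp hl)
  exact_mod_cast hlt

lemma newtonPoly_eval_zero (a : ℕ → ℝ) (k : ℕ) :
    (newtonPoly a (k + 1)).eval ((0 : ℕ) : ℝ) = a (k + 1) := by
  rw [newtonPoly_eval, Finset.sum_range_succ']
  simp

lemma newtonPoly_eval_succ (a : ℕ → ℝ) (k j : ℕ) :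
    (newtonPoly a (k + 1)).eval ((j + 1 : ℕ) : ℝ) =
      (newtonPoly a (k + 1)).eval (j : ℝ) + (newtonPoly a k).eval (j : ℝ) := by
  simp only [newtonPoly_eval]
  rw [Finset.sum_range_succ', Finset.sum_range_succ']
  simp only [Nat.choose_succ_succ, Nat.succ_eq_add_one, Nat.add_sub_add_right]
  push_cast
  simp only [mul_add, Finset.sum_add_distrib]
  simp
  ring

/-- Approximate Newton rows: if the bottom row is small and `K` entries of the `K`-th row are
small, then all rows are small, with an exponential loss. -/
lemma rows_bound (g : ℕ → ℕ → ℝ) (n₀ K : ℕ) (E ε A : ℝ) (hE : 0 ≤ E) (hεE : ε ≤ E)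
    (hA : 4 * ((n₀ + K : ℕ) + 1 : ℝ) ≤ A)
    (hbase : ∀ j ≤ n₀, |g 0 j| ≤ E)
    (hrec : ∀ k < K, ∀ j < n₀ + k + 1, |g (k + 1) (j + 1) - g (k + 1) j - g k j| ≤ ε)
    (Y : Finset ℕ) (hY : ∀ y ∈ Y, y ≤ n₀ + K) (hcard : K ≤ Y.card)
    (hYE : ∀ y ∈ Y, |g K y| ≤ E) :
    ∀ k ≤ K, ∀ j ≤ n₀ + k, |g k j| ≤ E * A ^ (5 * (n₀ + K)) := by
  set n := n₀ + K with hn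
  have hn0 : (0 : ℝ) ≤ (n : ℝ) := n.cast_nonneg
  have hA4 : 4 ≤ A := by linarith
  have hA1 : 1 ≤ A := by linarith
  obtain ⟨Z, hZY, hZc⟩ := Finset.exists_subset_card_eq hcard
  set a : ℕ → ℝ := fun k => g k 0 with ha
  have herr : ∀ k ≤ K, ∀ j ≤ n₀ + k,
      |g k j - (newtonPoly a k).eval (j : ℝ)| ≤ A ^ k * E := by
    intro k
    induction k with
    | zero =>
      intro _ j hj
      simpa [newtonPoly] using hbase j (by omega)
    | succ k ih =>
      intro hk j hj
      have hstep : ∀ j ≤ n₀ + (k + 1),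
          |g (k + 1) j - (newtonPoly a (k + 1)).eval (j : ℝ)| ≤ j * (2 * (A ^ k * E)) := by
        intro j
        induction j with
        | zero =>
          intro _
          rw [newtonPoly_eval_zero]
          simp [ha]
        | succ j ihj =>
          intro hj
          have h1 := ihj (by omega)
          have h2 := ih (by omega) j (by omega)
          have h3 := hrec k (by omega) j (by omega)
          have h4 : E ≤ A ^ k * E := le_mul_of_one_le_left hE (one_le_pow₀ hA1)
          rw [newtonPoly_eval_succ]
          rw [abs_le] at h1 h2 h3 ⊢
          push_cast
          constructor <;> nlinarith
      refine (hstep j hj).trans ?_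
      have hjn : (j : ℝ) ≤ n := by exact_mod_cast (by omega : j ≤ n)
      have : 0 ≤ A ^ k * E := by positivity
      calc (j : ℝ) * (2 * (A ^ k * E)) = (2 * j) * (A ^ k * E) := by ring
        _ ≤ A * (A ^ k * E) := by
          apply mul_le_mul_of_nonneg_right _ this
          linarith
        _ = _ := by ring
  have hP : ∀ j ≤ n, |(newtonPoly a K).eval (j : ℝ)| ≤ K * ((n + 1 : ℝ) ^ K * (2 * (A ^ K * E))) := by
    intro j hj
    have := abs_eval_le_of_nodes (newtonPoly a K) Z n (fun y hy => hY y (hZY hy))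
      (by rw [hZc]; exact newtonPoly_degree_lt a K) (2 * (A ^ K * E)) (by
        intro y hy
        have h1 := herr K le_rfl y (hY y (hZY hy))
        have h2 := hYE y (hZY hy)
        have h4 : E ≤ A ^ K * E := le_mul_of_one_le_left hE (one_le_pow₀ hA1)
        rw [abs_le] at h1 h2 ⊢
        constructor <;> linarith) j hj
    rwa [hZc] at this
  have htop : ∀ j ≤ n, |g K j| ≤ E * A ^ (2 * K + 2) := by
    intro j hj
    have h1 := herr K le_rfl j hj
    have h2 := hP j hj
    have h3 : |g K j| ≤ A ^ K * E + K * ((n + 1 : ℝ) ^ K * (2 * (A ^ K * E))) := by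
      rw [abs_le] at h1 h2 ⊢
      constructor <;> linarith
    refine h3.trans ?_
    have hKn : (K : ℝ) ≤ n := by exact_mod_cast (by omega : K ≤ n)
    have h5 : (n + 1 : ℝ) ^ K ≤ A ^ K := by
      apply pow_le_pow_left₀ (by positivity); linarith
    have h6 : A ^ K * E ≤ A ^ K * (A ^ K * E) :=
      le_mul_of_one_le_left (by positivity) (one_le_pow₀ hA1)
    have h7 : (2 * K : ℝ) * ((n + 1 : ℝ) ^ K * (A ^ K * E)) ≤ A * (A ^ K * (A ^ K * E)) := by
      apply mul_le_mul _ _ (by positivity) (by positivity)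
      · linarith
      · exact mul_le_mul_of_nonneg_right h5 (by positivity)
    have h8 : E * A ^ (2 * K + 2) = A * (A * (A ^ K * (A ^ K * E))) := by ring
    rw [h8]
    have h9 : 0 ≤ A ^ K * (A ^ K * E) := by positivity
    generalize A ^ K * (A ^ K * E) = W at *
    have h10 : (K : ℝ) * ((n + 1 : ℝ) ^ K * (2 * (A ^ K * E))) =
      (2 * K : ℝ) * ((n + 1 : ℝ) ^ K * (A ^ K * E)) := by ring
    rw [h10]
    have h11 : 0 ≤ A * W := by positivity
    nlinarith
  have hdown : ∀ i ≤ K, ∀ j ≤ n₀ + (K - i), |g (K - i) j| ≤ E * A ^ (2 * K + 2 + i) := by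
    intro i
    induction i with
    | zero =>
      intro _ j hj
      exact htop j hj
    | succ i ih =>
      intro hi j hj
      obtain ⟨k, hk⟩ : ∃ k, K - (i + 1) = k ∧ K - i = k + 1 := ⟨_, rfl, by omega⟩
      rw [hk.1] at hj ⊢
      have ih' := ih (by omega)
      rw [hk.2] at ih'
      have h1 := ih' j (by omega)
      have h2 := ih' (j + 1) (by omega)
      have h3 := hrec k (by omega) j (by omega)
      have h4 : E ≤ E * A ^ (2 * K + 2 + i) := le_mul_of_one_le_right hE (one_le_pow₀ hA1)
      have h5 : E * A ^ (2 * K + 2 + (i + 1)) = A * (E * A ^ (2 * K + 2 + i)) := by ring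
      rw [h5]
      rw [abs_le] at h1 h2 h3 ⊢
      constructor <;> nlinarith
  intro k hk j hj
  rcases Nat.eq_zero_or_pos K with hK | hK
  · have : k = 0 := by omega
    subst this
    refine (hbase j (by omega)).trans (le_mul_of_one_le_right hE (one_le_pow₀ hA1))
  have := hdown (K - k) (by omega) j (by omega)
  rw [show K - (K - k) = k by omega] at this
  refine this.trans (mul_le_mul_of_nonneg_left (pow_le_pow_right₀ hA1 ?_) hE)
  omega

/-- All values of `v` on the triangle `{x ≥ a, y ≥ b, z ≥ c, x + y + z = S}` are at most `E`. -/
def SmallOn (v : ℤ → ℤ → ℤ → ℝ) (E : ℝ) (a b c S : ℤ) : Prop :=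
  ∀ x y z, a ≤ x → b ≤ y → c ≤ z → x + y + z = S → |v x y z| ≤ E

/-- On the triangle `{x ≥ a, y ≥ b, z ≥ c, x + y + z = S}` the three values of `v` at the corners
of every upward unit triangle sum to at most `ε`. -/
def TriRule (v : ℤ → ℤ → ℤ → ℝ) (ε : ℝ) (a b c S : ℤ) : Prop :=
  ∀ x y z, a ≤ x → b ≤ y → c ≤ z → x + y + z + 1 = S →
    |v (x + 1) y z + v x (y + 1) z + v x y (z + 1)| ≤ ε

lemma SmallOn.expand {v : ℤ → ℤ → ℤ → ℝ} {E ε A : ℝ} {a a' b c S : ℤ} (hE : 0 ≤ E)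
    (h : SmallOn v E a b c S) (hrule : TriRule v ε a' b c S) (hε : ε ≤ E)
    (ha : a' ≤ a) (hS : a + b + c ≤ S) (n : ℕ) (hn : S - a' - b - c ≤ n)
    (hA : 4 * ((n : ℝ) + 1) ≤ A) (L : Finset ℤ) (hL : (L.card : ℤ) ≤ S - a - b - c)
    (hrow : ∀ y z, b ≤ y → c ≤ z → a' + y + z = S → y ∉ L → |v a' y z| ≤ E) :
    SmallOn v (E * A ^ (5 * n)) a' b c S := by
  obtain ⟨n₀, hn₀⟩ := Int.eq_ofNat_of_zero_le (show 0 ≤ S - a - b - c by omega)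
  obtain ⟨K, hK⟩ := Int.eq_ofNat_of_zero_le (show 0 ≤ a - a' by omega)
  have hnK : n₀ + K ≤ n := by omega
  have hA1 : 1 ≤ A := by linarith [n.cast_nonneg (α := ℝ)]
  set g : ℕ → ℕ → ℝ := fun k j => (-1) ^ j * v (a - k) (b + j) (S - a + k - b - j) with hg
  have habs : ∀ k j : ℕ, |g k j| = |v (a - k) (b + j) (S - a + k - b - j)| := by
    intro k j
    simp [hg, abs_mul]
  set Y := (Finset.range (n₀ + K + 1)).filter (fun j : ℕ => b + (j : ℤ) ∉ L) with hYdef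
  have hYc : K ≤ Y.card := by
    have h1 := Finset.card_filter_add_card_filter_not (s := Finset.range (n₀ + K + 1))
      (fun j : ℕ => b + (j : ℤ) ∈ L)
    have h2 : ((Finset.range (n₀ + K + 1)).filter (fun j : ℕ => b + (j : ℤ) ∈ L)).card ≤ L.card := by
      apply Finset.card_le_card_of_injOn (fun j : ℕ => b + (j : ℤ))
      · intro j hj
        exact (Finset.mem_filter.mp hj).2
      · intro i _ j _ hij
        simpa using hij
    rw [Finset.card_range, ← hYdef] at h1
    omega
  have key := rows_bound g n₀ K E ε A hE hε (by
      have : ((n₀ + K : ℕ) : ℝ) ≤ n := by exact_mod_cast hnK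
      linarith) (by
      intro j hj
      rw [habs]
      apply h <;> push_cast <;> omega) (by
      intro k hk j hj
      have := hrule (a - k - 1) (b + j) (S - a + k - b - j) (by omega) (by omega) (by omega)
        (by ring)
      have e : g (k + 1) (j + 1) - g (k + 1) j - g k j =
          -((-1) ^ j * (v (a - k - 1 + 1) (b + j) (S - a + k - b - j) +
            v (a - k - 1) (b + j + 1) (S - a + k - b - j) +
            v (a - k - 1) (b + j) (S - a + k - b - j + 1))) := by
        simp only [hg]
        push_cast
        rw [show a - ((k : ℤ) + 1) = a - k - 1 by ring, show b + ((j : ℤ) + 1) = b + j + 1 by ring,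
          show S - a + ((k : ℤ) + 1) - b - (j + 1) = S - a + k - b - j by ring,
          show S - a + ((k : ℤ) + 1) - b - j = S - a + k - b - j + 1 by ring,
          show a - (k : ℤ) - 1 + 1 = a - k by ring]
        ring
      rw [e, abs_neg, abs_mul]
      simpa using this) Y (by
      intro y hy
      have := Finset.mem_range.mp (Finset.mem_filter.mp hy).1
      omega) hYc (by
      intro y hy
      have h1 := Finset.mem_range.mp (Finset.mem_filter.mp hy).1
      have h2 := (Finset.mem_filter.mp hy).2
      rw [habs, show a - (K : ℤ) = a' by omega]
      exact hrow _ _ (by omega) (by omega) (by omega) h2)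
  intro x y z hx hy hz hxyz
  by_cases hxa : a ≤ x
  · exact (h x y z hxa hy hz hxyz).trans (le_mul_of_one_le_right hE (one_le_pow₀ hA1))
  · have := key (a - x).toNat (by omega) (y - b).toNat (by omega)
    rw [habs] at this
    rw [show a - ((a - x).toNat : ℤ) = x by omega, show b + ((y - b).toNat : ℤ) = y by omega,
      show S - a + ((a - x).toNat : ℤ) - b - ((y - b).toNat : ℤ) = z by omega] at this
    refine this.trans (mul_le_mul_of_nonneg_left (pow_le_pow_right₀ hA1 ?_) hE)
    omega

lemma SmallOn.expand_snd {v : ℤ → ℤ → ℤ → ℝ} {E ε A : ℝ} {a b b' c S : ℤ} (hE : 0 ≤ E)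
    (h : SmallOn v E a b c S) (hrule : TriRule v ε a b' c S) (hε : ε ≤ E)
    (hb : b' ≤ b) (hS : a + b + c ≤ S) (n : ℕ) (hn : S - a - b' - c ≤ n)
    (hA : 4 * ((n : ℝ) + 1) ≤ A) (L : Finset ℤ) (hL : (L.card : ℤ) ≤ S - a - b - c)
    (hrow : ∀ x z, a ≤ x → c ≤ z → x + b' + z = S → x ∉ L → |v x b' z| ≤ E) :
    SmallOn v (E * A ^ (5 * n)) a b' c S := by
  have h1 : SmallOn (fun y x z => v x y z) E b a c S :=
    fun y x z hy hx hz hs => h x y z hx hy hz (by omega)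
  have h2 : TriRule (fun y x z => v x y z) ε b' a c S := by
    intro y x z hy hx hz hs
    have := hrule x y z hx hy hz (by omega)
    rwa [add_comm (v (x + 1) y z)] at this
  have h3 := h1.expand hE h2 hε hb (by omega) n (by omega) hA L (by omega)
    (fun x z hx hz hs hxL => hrow x z hx hz (by omega) hxL)
  exact fun x y z hx hy hz hs => h3 y x z hy hx hz (by omega)

lemma SmallOn.expand_trd {v : ℤ → ℤ → ℤ → ℝ} {E ε A : ℝ} {a b c c' S : ℤ} (hE : 0 ≤ E)
    (h : SmallOn v E a b c S) (hrule : TriRule v ε a b c' S) (hε : ε ≤ E)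
    (hc : c' ≤ c) (hS : a + b + c ≤ S) (n : ℕ) (hn : S - a - b - c' ≤ n)
    (hA : 4 * ((n : ℝ) + 1) ≤ A) (L : Finset ℤ) (hL : (L.card : ℤ) ≤ S - a - b - c)
    (hrow : ∀ x y, a ≤ x → b ≤ y → x + y + c' = S → x ∉ L → |v x y c'| ≤ E) :
    SmallOn v (E * A ^ (5 * n)) a b c' S := by
  have h1 : SmallOn (fun z x y => v x y z) E c a b S :=
    fun z x y hz hx hy hs => h x y z hx hy hz (by omega)
  have h2 : TriRule (fun z x y => v x y z) ε c' a b S := by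
    intro z x y hz hx hy hs
    have := hrule x y z hx hy hz (by omega)
    rwa [add_comm, ← add_assoc] at this
  have h3 := h1.expand hE h2 hε hc (by omega) n (by omega) hA L (by omega)
    (fun x y hx hy hs hxL => hrow x y hx hy (by omega) hxL)
  exact fun x y z hx hy hz hs => h3 z x y hz hx hy (by omega)

/-- `v` is at most `M` at the points of the triangle `{x ≥ a, y ≥ b, z ≥ c, x + y + z = S}`
outside `G`. -/
def SmallOff (v : ℤ → ℤ → ℤ → ℝ) (M : ℝ) (G : Finset (ℤ × ℤ × ℤ)) (a b c S : ℤ) : Prop :=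
  ∀ x y z, a ≤ x → b ≤ y → c ≤ z → x + y + z = S → (x, y, z) ∉ G → |v x y z| ≤ M

lemma TriRule.mono {v : ℤ → ℤ → ℤ → ℝ} {ε : ℝ} {a b c a' b' c' S : ℤ}
    (h : TriRule v ε a b c S) (ha : a ≤ a') (hb : b ≤ b') (hc : c ≤ c') :
    TriRule v ε a' b' c' S :=
  fun x y z hx hy hz hs => h x y z (ha.trans hx) (hb.trans hy) (hc.trans hz) hs

lemma SmallOff.mono {v : ℤ → ℤ → ℤ → ℝ} {ε : ℝ} {G : Finset (ℤ × ℤ × ℤ)}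
    {a b c a' b' c' S : ℤ} (h : SmallOff v ε G a b c S)
    (ha : a ≤ a') (hb : b ≤ b') (hc : c ≤ c') : SmallOff v ε G a' b' c' S :=
  fun x y z hx hy hz hs => h x y z (ha.trans hx) (hb.trans hy) (hc.trans hz) hs

lemma SmallOn.expand_all {v : ℤ → ℤ → ℤ → ℝ} {E ε A : ℝ} {a b c a' b' c' S : ℤ}
    {G : Finset (ℤ × ℤ × ℤ)} (hE : 0 ≤ E)
    (h : SmallOn v E a b c S) (hrule : TriRule v ε a' b' c' S)
    (hoff : SmallOff v ε G a' b' c' S) (hε : ε ≤ E)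
    (ha : a' ≤ a) (hb : b' ≤ b) (hc : c' ≤ c) (hS : a + b + c ≤ S)
    (n : ℕ) (hn : S - a' - b' - c' ≤ n) (hA : 4 * ((n : ℝ) + 1) ≤ A)
    (hGa : ((G.filter (fun q => q.1 = a')).card : ℤ) ≤ S - a - b - c)
    (hGb : ((G.filter (fun q => q.2.1 = b')).card : ℤ) ≤ S - a - b - c)
    (hGc : ((G.filter (fun q => q.2.2 = c')).card : ℤ) ≤ S - a - b - c) :
    SmallOn v (E * A ^ (15 * n)) a' b' c' S := by
  have hA1 : 1 ≤ A := by linarith [n.cast_nonneg (α := ℝ)]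
  have hpow : ∀ k, E ≤ E * A ^ k := fun k => le_mul_of_one_le_right hE (one_le_pow₀ hA1)
  have h1 := h.expand hE (hrule.mono le_rfl hb hc) hε ha hS n (by omega) hA
    ((G.filter (fun q => q.1 = a')).image (fun q => q.2.1))
    (by
      have := Finset.card_image_le (s := G.filter (fun q => q.1 = a')) (f := fun q => q.2.1)
      omega)
    (by
      intro y z hy hz hs hL
      refine (hoff a' y z le_rfl (hb.trans hy) (hc.trans hz) hs fun hG => hL ?_).trans hε
      exact Finset.mem_image.mpr ⟨_, Finset.mem_filter.mpr ⟨hG, rfl⟩, rfl⟩)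
  have h2 := h1.expand_snd (by positivity) (hrule.mono le_rfl le_rfl hc) (hε.trans (hpow _)) hb
    (by omega) n (by omega) hA
    ((G.filter (fun q => q.2.1 = b')).image (fun q => q.1))
    (by
      have := Finset.card_image_le (s := G.filter (fun q => q.2.1 = b')) (f := fun q => q.1)
      omega)
    (by
      intro x z hx hz hs hL
      refine (hoff x b' z hx le_rfl (hc.trans hz) hs fun hG => hL ?_).trans
        (hε.trans (hpow _))
      exact Finset.mem_image.mpr ⟨_, Finset.mem_filter.mpr ⟨hG, rfl⟩, rfl⟩)
  have h3 := h2.expand_trd (by positivity) hrule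
    (hε.trans (by rw [mul_assoc, ← pow_add]; exact hpow _)) hc
    (by omega) n (by omega) hA
    ((G.filter (fun q => q.2.2 = c')).image (fun q => q.1))
    (by
      have := Finset.card_image_le (s := G.filter (fun q => q.2.2 = c')) (f := fun q => q.1)
      omega)
    (by
      intro x y hx hy hs hL
      refine (hoff x y c' hx hy le_rfl hs fun hG => hL ?_).trans
        (hε.trans (by rw [mul_assoc, ← pow_add]; exact hpow _))
      exact Finset.mem_image.mpr ⟨_, Finset.mem_filter.mpr ⟨hG, rfl⟩, rfl⟩)
  rw [mul_assoc, ← pow_add, mul_assoc, ← pow_add] at h3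
  rwa [show 15 * n = 5 * n + (5 * n + 5 * n) by ring]

/-- The points of `G` in the sup-norm ball of radius `ρ` around `(p₁, p₂, p₃)`. -/
def ballPart (G : Finset (ℤ × ℤ × ℤ)) (p₁ p₂ p₃ ρ : ℤ) : Finset (ℤ × ℤ × ℤ) :=
  G.filter (fun q => |q.1 - p₁| ≤ ρ ∧ |q.2.1 - p₂| ≤ ρ ∧ |q.2.2 - p₃| ≤ ρ)

/-- Pigeonhole: among `l + 1` consecutive values of `f` some value has a small fibre. -/
lemma exists_small_fibre {ι : Type*} (G : Finset ι) (f : ι → ℤ) (lo : ℤ) (l k : ℕ)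
    (h : G.card ≤ (l + 1) * k) :
    ∃ i, lo ≤ i ∧ i ≤ lo + l ∧ (G.filter (fun q => f q = i)).card ≤ k := by
  obtain ⟨i, hi, hc⟩ := Finset.exists_card_fiber_le_of_card_le_mul (s := G)
    (t := Finset.Icc lo (lo + l)) (f := f) (n := k) ⟨lo, by simp⟩ (by
      rw [Int.card_Icc, show (lo + (l : ℤ) + 1 - lo).toNat = l + 1 by omega]
      exact h)
  rw [Finset.mem_Icc] at hi
  exact ⟨i, hi.1, hi.2, hc⟩

lemma exists_smallOn_dyadic {v : ℤ → ℤ → ℤ → ℝ} {ε A : ℝ} {p₁ p₂ p₃ S : ℤ}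
    {G : Finset (ℤ × ℤ × ℤ)} {J : ℕ} (hε : 0 ≤ ε) (hp : p₁ + p₂ + p₃ = S)
    (hrule : TriRule v ε (p₁ - 2 * 2 ^ J) (p₂ - 2 * 2 ^ J) (p₃ - 2 * 2 ^ J) S)
    (hoff : SmallOff v ε G (p₁ - 2 * 2 ^ J) (p₂ - 2 * 2 ^ J) (p₃ - 2 * 2 ^ J) S)
    (hA : 4 * (12 * 2 ^ J + 1) ≤ A)
    (hG : ∀ j ≤ J, 2 * (ballPart G p₁ p₂ p₃ (4 * 2 ^ j)).card ≤ 4 ^ j) :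
    ∀ j ≤ J, ∃ a b c : ℤ, (p₁ - 2 * 2 ^ j ≤ a ∧ a ≤ p₁ - 2 ^ j) ∧
      (p₂ - 2 * 2 ^ j ≤ b ∧ b ≤ p₂ - 2 ^ j) ∧ (p₃ - 2 * 2 ^ j ≤ c ∧ c ≤ p₃ - 2 ^ j) ∧
      SmallOn v (ε * A ^ (180 * 2 ^ j)) a b c S := by
  have hA1 : 1 ≤ A := by
    have : (0 : ℝ) < 2 ^ J := by positivity
    linarith
  intro j
  induction j with
  | zero =>
    intro _
    refine ⟨p₁ - 1, p₂ - 1, p₃ - 1, by norm_num, by norm_num, by norm_num, ?_⟩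
    intro x y z hx hy hz hs
    have h0 := hG 0 (Nat.zero_le _)
    have h1 : (ballPart G p₁ p₂ p₃ (4 * 2 ^ 0)).card = 0 := by omega
    have hJ1 : (1 : ℤ) ≤ 2 ^ J := one_le_pow₀ (by norm_num)
    refine (hoff x y z (by omega) (by omega) (by omega) hs fun hm => ?_).trans
      (le_mul_of_one_le_right hε (one_le_pow₀ hA1))
    rw [Finset.card_eq_zero] at h1
    have : (x, y, z) ∈ ballPart G p₁ p₂ p₃ (4 * 2 ^ 0) := by
      refine Finset.mem_filter.mpr ⟨hm, ?_⟩
      simp only [abs_le]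
      omega
    rw [h1] at this
    simp at this
  | succ j ih =>
    intro hj
    obtain ⟨a, b, c, ha, hb, hc, hsm⟩ := ih (by omega)
    obtain ⟨w, hw⟩ : ∃ w : ℕ, w = 2 ^ j := ⟨_, rfl⟩
    have hwZ : (2 : ℤ) ^ j = w := by rw [hw]; push_cast; rfl
    have hwJ : 2 * (w : ℤ) ≤ 2 ^ J := by
      rw [← hwZ, ← pow_succ']
      exact pow_le_pow_right₀ (by norm_num) hj
    have hcard : (ballPart G p₁ p₂ p₃ (4 * 2 ^ (j + 1))).card ≤ (2 * w + 1) * w := by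
      have h0 := hG (j + 1) hj
      have h4 : 4 ^ (j + 1) = 4 * (w * w) := by
        rw [hw, pow_succ, ← mul_pow]; ring
      nlinarith
    have hw1 : 1 ≤ w := by rw [hw]; exact Nat.one_le_two_pow
    rw [pow_succ] at hcard
    rw [hwZ] at ha hb hc hcard
    obtain ⟨a', ha1, ha2, ha3⟩ := exists_small_fibre _ (fun q => q.1) (p₁ - 4 * w) (2 * w) w hcard
    obtain ⟨b', hb1, hb2, hb3⟩ := exists_small_fibre _ (fun q => q.2.1) (p₂ - 4 * w) (2 * w) w hcard
    obtain ⟨c', hc1, hc2, hc3⟩ := exists_small_fibre _ (fun q => q.2.2) (p₃ - 4 * w) (2 * w) w hcard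
    push_cast at ha2 hb2 hc2
    refine ⟨a', b', c', ?_, ?_, ?_, ?_⟩
    · rw [pow_succ, hwZ]; omega
    · rw [pow_succ, hwZ]; omega
    · rw [pow_succ, hwZ]; omega
    have hoff' : SmallOff v ε (ballPart G p₁ p₂ p₃ (4 * (w * 2))) a' b' c' S := by
      intro x y z hx hy hz hs hm
      refine hoff x y z (by omega) (by omega) (by omega) hs fun hxG => hm ?_
      refine Finset.mem_filter.mpr ⟨hxG, ?_⟩
      simp only [abs_le]
      omega
    have hres := hsm.expand_all (by positivity)
      (hrule.mono (a' := a') (b' := b') (c' := c') (by omega) (by omega) (by omega)) hoff'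
      (le_mul_of_one_le_right hε (one_le_pow₀ hA1)) (by omega) (by omega) (by omega) (by omega)
      (12 * w) (by push_cast; omega) (by
        have : (2 * w : ℝ) ≤ 2 ^ J := by exact_mod_cast hwJ
        have h0 : (0 : ℝ) ≤ w := w.cast_nonneg
        push_cast
        linarith) (by omega) (by omega) (by omega)
    rw [mul_assoc, ← pow_add] at hres
    rwa [show 180 * 2 ^ (j + 1) = 180 * 2 ^ j + 15 * (12 * w) by rw [hw]; ring]

lemma sum_card_ballPart_le (G : Finset (ℤ × ℤ × ℤ)) (W : Finset (ℤ × ℤ)) (S : ℤ) (ρ : ℕ) :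
    ∑ w ∈ W, (ballPart G w.1 w.2 (S - w.1 - w.2) ρ).card ≤ G.card * (2 * ρ + 1) ^ 2 := by
  have h1 := Finset.sum_card_bipartiteAbove_eq_sum_card_bipartiteBelow (s := W) (t := G)
    (fun w q => |q.1 - w.1| ≤ (ρ : ℤ) ∧ |q.2.1 - w.2| ≤ (ρ : ℤ) ∧
      |q.2.2 - (S - w.1 - w.2)| ≤ (ρ : ℤ))
  refine (le_of_eq h1).trans ?_
  rw [← smul_eq_mul]
  refine Finset.sum_le_card_nsmul _ _ _ fun q _ => ?_
  have h2 : (Finset.Icc (q.1 - ρ) (q.1 + ρ) ×ˢ Finset.Icc (q.2.1 - ρ) (q.2.1 + ρ)).card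
      = (2 * ρ + 1) ^ 2 := by
    rw [Finset.card_product, Int.card_Icc, Int.card_Icc,
      show (q.1 + (ρ : ℤ) + 1 - (q.1 - ρ)).toNat = 2 * ρ + 1 by omega,
      show (q.2.1 + (ρ : ℤ) + 1 - (q.2.1 - ρ)).toNat = 2 * ρ + 1 by omega]
    ring
  rw [← h2]
  refine Finset.card_le_card fun w hw => ?_
  have := (Finset.mem_filter.mp hw).2
  simp only [abs_le] at this
  rw [Finset.mem_product, Finset.mem_Icc, Finset.mem_Icc]
  omega

lemma exists_good_centre (G : Finset (ℤ × ℤ × ℤ)) (W : Finset (ℤ × ℤ)) (S : ℤ) (J : ℕ)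
    (h : 162 * (J + 1) * G.card < W.card) :
    ∃ w ∈ W, ∀ j ≤ J, 2 * (ballPart G w.1 w.2 (S - w.1 - w.2) (4 * 2 ^ j)).card ≤ 4 ^ j := by
  by_contra! hcon
  set bad : ℕ → Finset (ℤ × ℤ) := fun j => W.filter
    (fun w => 4 ^ j < 2 * (ballPart G w.1 w.2 (S - w.1 - w.2) (4 * 2 ^ j)).card) with hbad
  have hbc : ∀ j, (bad j).card ≤ 162 * G.card := by
    intro j
    have h1 := sum_card_ballPart_le G W S (4 * 2 ^ j)
    have h2 : (bad j).card * 4 ^ j ≤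
        ∑ w ∈ W, 2 * (ballPart G w.1 w.2 (S - w.1 - w.2) (4 * 2 ^ j)).card := by
      rw [← smul_eq_mul]
      refine (Finset.card_nsmul_le_sum (bad j) _ _ fun w hw => ?_).trans
        (Finset.sum_le_sum_of_subset (Finset.filter_subset _ _))
      exact (Finset.mem_filter.mp hw).2.le
    rw [← Finset.mul_sum] at h2
    push_cast at h1
    have h3 : (2 * (4 * 2 ^ j) + 1) ^ 2 ≤ 81 * 4 ^ j := by
      have : (4 : ℕ) ^ j = 2 ^ j * 2 ^ j := by rw [← mul_pow]; norm_num
      rw [this]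
      have : 1 ≤ 2 ^ j := Nat.one_le_two_pow
      nlinarith
    have h4 : (0 : ℕ) < 4 ^ j := by positivity
    have h5 : G.card * (2 * (4 * 2 ^ j) + 1) ^ 2 ≤ G.card * (81 * 4 ^ j) :=
      Nat.mul_le_mul_left _ h3
    refine Nat.le_of_mul_le_mul_right ?_ h4
    nlinarith
  have hsub : W ⊆ (Finset.range (J + 1)).biUnion bad := by
    intro w hw
    obtain ⟨j, hj, hlt⟩ := hcon w hw
    exact Finset.mem_biUnion.mpr ⟨j, by simp; omega, Finset.mem_filter.mpr ⟨hw, hlt⟩⟩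
  have h1 := (Finset.card_le_card hsub).trans
    (Finset.card_biUnion_le_card_mul _ _ _ fun j _ => hbc j)
  rw [Finset.card_range] at h1
  nlinarith

/-- A row at moderate distance below `q` with few points of `G`. -/
lemma exists_side (G : Finset (ℤ × ℤ × ℤ)) (f : ℤ × ℤ × ℤ → ℤ) (a q : ℤ) (s k : ℕ) (haq : a ≤ q)
    (ha : (G.filter (fun p => f p = a)).card ≤ k) (hG : G.card ≤ (s + 1) * k) :
    ∃ a', a ≤ a' ∧ a' ≤ q ∧ q - a' ≤ 2 * s ∧ (a' = a ∨ s ≤ q - a') ∧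
      (G.filter (fun p => f p = a')).card ≤ k := by
  by_cases h : q - a ≤ 2 * s
  · exact ⟨a, le_rfl, haq, h, Or.inl rfl, ha⟩
  · obtain ⟨i, h1, h2, h3⟩ := exists_small_fibre G f (q - 2 * s) s k hG
    exact ⟨i, by omega, by omega, by omega, Or.inr (by omega), h3⟩

lemma SmallOff.smallOn {v : ℤ → ℤ → ℤ → ℝ} {ε A : ℝ} {a b c S : ℤ}
    {G : Finset (ℤ × ℤ × ℤ)} {J : ℕ} (hoff : SmallOff v ε G a b c S) (hε : 0 ≤ ε)
    (hS : a + b + c + 32 * 2 ^ J ≤ S) (hrule : TriRule v ε a b c S)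
    (hA : 4 * (192 * 2 ^ J + 1) ≤ A) (hG : 162 * (J + 1) * G.card < 16 * (2 ^ J) ^ 2)
    (hGa : (G.filter (fun q => q.1 = a)).card ≤ 3 * 2 ^ J)
    (hGb : (G.filter (fun q => q.2.1 = b)).card ≤ 3 * 2 ^ J)
    (hGc : (G.filter (fun q => q.2.2 = c)).card ≤ 3 * 2 ^ J) :
    SmallOn v (ε * A ^ (3060 * 2 ^ J)) a b c S := by
  obtain ⟨α, hα⟩ : ∃ α : ℕ, α = 2 ^ J := ⟨_, rfl⟩
  have hαZ : (2 : ℤ) ^ J = α := by rw [hα]; push_cast; rfl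
  have hαR : (2 : ℝ) ^ J = α := by rw [hα]; push_cast; rfl
  have hα1 : 1 ≤ α := by rw [hα]; exact Nat.one_le_two_pow
  rw [← hα] at hG hGa hGb hGc ⊢
  rw [hαZ] at hS
  rw [hαR] at hA
  have hα1R : (1 : ℝ) ≤ α := by exact_mod_cast hα1
  have hA1 : 1 ≤ A := by linarith
  have hGs : G.card ≤ (32 * α + 1) * (3 * α) := by nlinarith
  intro x y z hx hy hz hs
  obtain ⟨a', ha1, ha2, ha3, ha4, ha5⟩ := exists_side G (fun q => q.1) a x (32 * α) _ hx hGa hGs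
  obtain ⟨b', hb1, hb2, hb3, hb4, hb5⟩ := exists_side G (fun q => q.2.1) b y (32 * α) _ hy hGb hGs
  obtain ⟨c', hc1, hc2, hc3, hc4, hc5⟩ := exists_side G (fun q => q.2.2) c z (32 * α) _ hz hGc hGs
  push_cast at ha3 hb3 hc3 ha4 hb4 hc4
  have hsize : 32 * (α : ℤ) ≤ S - a' - b' - c' := by omega
  obtain ⟨w, hw, hball⟩ := exists_good_centre G
    (Finset.Ico (a' + 4 * α) (a' + 8 * α) ×ˢ Finset.Ico (b' + 4 * α) (b' + 8 * α)) S J (by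
      rw [Finset.card_product, Int.card_Ico, Int.card_Ico,
        show (a' + 8 * (α : ℤ) - (a' + 4 * α)).toNat = 4 * α by omega,
        show (b' + 8 * (α : ℤ) - (b' + 4 * α)).toNat = 4 * α by omega]
      nlinarith)
  rw [Finset.mem_product, Finset.mem_Ico, Finset.mem_Ico] at hw
  obtain ⟨a₁, b₁, c₁, ha₁, hb₁, hc₁, hsm⟩ := exists_smallOn_dyadic (A := A) hε
    (show w.1 + w.2 + (S - w.1 - w.2) = S by ring)
    (hrule.mono (by rw [hαZ]; omega) (by rw [hαZ]; omega) (by rw [hαZ]; omega))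
    (hoff.mono (by rw [hαZ]; omega) (by rw [hαZ]; omega) (by rw [hαZ]; omega))
    (by rw [hαR]; linarith) hball J le_rfl
  rw [hαZ] at ha₁ hb₁ hc₁
  have hres := hsm.expand_all (A := A) (by positivity) (hrule.mono ha1 hb1 hc1) (hoff.mono ha1 hb1 hc1)
    (le_mul_of_one_le_right hε (one_le_pow₀ hA1)) (by omega) (by omega) (by omega) (by omega)
    (192 * α) (by push_cast; omega) (by push_cast; linarith) (by omega) (by omega) (by omega)
  rw [mul_assoc, ← pow_add, ← hα, show 180 * α + 15 * (192 * α) = 3060 * α by ring] at hres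
  exact hres x y z ha2 hb2 hc2 hs

/-- The sum of `u` over the six nearest neighbours of `(x, y, z)`. -/
def nbrSum (u : ℤ → ℤ → ℤ → ℝ) (x y z : ℤ) : ℝ :=
  u (x + 1) y z + u (x - 1) y z + u x (y + 1) z + u x (y - 1) z + u x y (z + 1) + u x y (z - 1)

/-- The points of `G` on the plane `x + y + z = t`. -/
def levelPart (G : Finset (ℤ × ℤ × ℤ)) (t : ℤ) : Finset (ℤ × ℤ × ℤ) :=
  G.filter (fun p => p.1 + p.2.1 + p.2.2 = t)

lemma climb_levels {u : ℤ → ℤ → ℤ → ℝ} {κ M A : ℝ} {m : ℕ} (hm : 1 ≤ m) (hκ : 0 ≤ κ) (hM : 0 ≤ M)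
    (hu : ∀ x y z : ℤ, -20 * (m : ℤ) ≤ x → x ≤ 40 * m + 1 → -20 * (m : ℤ) ≤ y → y ≤ 40 * m + 1 →
      -20 * (m : ℤ) ≤ z → z ≤ 40 * m + 1 → 1 ≤ x + y + z → x + y + z ≤ 40 * m - 1 →
      |nbrSum u x y z| ≤ κ * |u x y z|)
    (hbase : ∀ x y z : ℤ, -20 * (m : ℤ) ≤ x → x ≤ 40 * m + 1 → -20 * (m : ℤ) ≤ y →
      y ≤ 40 * m + 1 → -20 * (m : ℤ) ≤ z → z ≤ 40 * m + 1 → (x + y + z = 0 ∨ x + y + z = 1) →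
      |u x y z| ≤ M)
    (G : Finset (ℤ × ℤ × ℤ))
    (hoff : ∀ x y z : ℤ, -20 * (m : ℤ) ≤ x → x ≤ 40 * m + 1 → -20 * (m : ℤ) ≤ y →
      y ≤ 40 * m + 1 → -20 * (m : ℤ) ≤ z → z ≤ 40 * m + 1 → 0 ≤ x + y + z → x + y + z ≤ 40 * m →
      (x, y, z) ∉ G → |u x y z| ≤ M)
    (w₁ w₂ w₃ : ℤ) (hw₁ : 0 ≤ w₁ ∧ w₁ ≤ 2 * m) (hw₂ : 0 ≤ w₂ ∧ w₂ ≤ 2 * m)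
    (hw₃ : 0 ≤ w₃ ∧ w₃ ≤ 2 * m) (J : ℕ → ℕ) (hJm : ∀ t, 2 ^ J t ≤ m)
    (hA : 4 * (192 * (m : ℝ) + 1) ≤ A)
    (hG : ∀ t : ℕ, 162 * (J t + 1) * (levelPart G t).card < 16 * (2 ^ J t) ^ 2)
    (hs₁ : ∀ t : ℕ, ((levelPart G t).filter
      (fun q => q.1 = ((t : ℤ) + 1) / 2 - 20 * m + w₁)).card ≤ 3 * 2 ^ J t)
    (hs₂ : ∀ t : ℕ, ((levelPart G t).filter
      (fun q => q.2.1 = ((t : ℤ) + 1) / 2 - 20 * m + w₂)).card ≤ 3 * 2 ^ J t)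
    (hs₃ : ∀ t : ℕ, ((levelPart G t).filter
      (fun q => q.2.2 = ((t : ℤ) + 1) / 2 - 20 * m + w₃)).card ≤ 3 * 2 ^ J t)
    (t : ℕ) (ht : t ≤ 40 * m) :
    SmallOn u (M * (κ + 3) ^ t * A ^ (3060 * ∑ i ∈ Finset.range (t + 1), 2 ^ J i))
      (((t : ℤ) + 1) / 2 - 20 * m + w₁) (((t : ℤ) + 1) / 2 - 20 * m + w₂)
      (((t : ℤ) + 1) / 2 - 20 * m + w₃) t := by
  set E : ℕ → ℝ := fun t => M * (κ + 3) ^ t * A ^ (3060 * ∑ i ∈ Finset.range (t + 1), 2 ^ J i)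
    with hE
  have hA1 : 1 ≤ A := by linarith [m.cast_nonneg (α := ℝ)]
  have hEM : ∀ t, M ≤ E t := by
    intro t
    simp only [hE]
    rw [mul_assoc]
    refine le_mul_of_one_le_right hM ?_
    exact one_le_mul_of_one_le_of_one_le (one_le_pow₀ (by linarith)) (one_le_pow₀ hA1)
  have hE0 : ∀ t, 0 ≤ E t := fun t => hM.trans (hEM t)
  have hEs : ∀ t, E (t + 1) = (κ + 3) * E t * A ^ (3060 * 2 ^ J (t + 1)) := by
    intro t
    simp only [hE]
    rw [Finset.sum_range_succ _ (t + 1), mul_add, pow_add, pow_succ]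
    ring
  have hEmono : ∀ t, E t ≤ E (t + 1) := by
    intro t
    rw [hEs, mul_comm (κ + 3), mul_assoc]
    refine le_mul_of_one_le_right (hE0 t) ?_
    exact one_le_mul_of_one_le_of_one_le (by linarith) (one_le_pow₀ hA1)
  suffices H : ∀ t : ℕ, t + 1 ≤ 40 * m →
      SmallOn u (E t) (((t : ℤ) + 1) / 2 - 20 * m + w₁) (((t : ℤ) + 1) / 2 - 20 * m + w₂)
        (((t : ℤ) + 1) / 2 - 20 * m + w₃) t ∧
      SmallOn u (E (t + 1)) (((t : ℤ) + 2) / 2 - 20 * m + w₁) (((t : ℤ) + 2) / 2 - 20 * m + w₂)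
        (((t : ℤ) + 2) / 2 - 20 * m + w₃) (t + 1) by
    rcases Nat.eq_zero_or_pos t with h0 | h0
    · subst h0
      exact (H 0 (by omega)).1
    · obtain ⟨s, rfl⟩ : ∃ s, t = s + 1 := ⟨t - 1, by omega⟩
      have := (H s ht).2
      push_cast
      rwa [show (s : ℤ) + 1 + 1 = s + 2 by ring]
  intro t
  induction t with
  | zero =>
    intro _
    constructor
    · intro x y z hx hy hz hs
      exact (hbase x y z (by omega) (by omega) (by omega) (by omega) (by omega) (by omega)
        (by omega)).trans (hEM _)
    · intro x y z hx hy hz hs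
      exact (hbase x y z (by omega) (by omega) (by omega) (by omega) (by omega) (by omega)
        (by omega)).trans (hEM _)
  | succ t ih =>
    intro ht
    obtain ⟨ih0, ih1⟩ := ih (by omega)
    push_cast
    rw [show (t : ℤ) + 1 + 1 = t + 2 by ring, show (t : ℤ) + 1 + 2 = t + 3 by ring]
    refine ⟨ih1, ?_⟩
    rw [hEs]
    have hJ : (2 : ℤ) ^ J (t + 2) ≤ m := by exact_mod_cast hJm (t + 2)
    have hJR : (2 : ℝ) ^ J (t + 2) ≤ m := by exact_mod_cast hJm (t + 2)
    have e1 : ((t + 2 : ℕ) : ℤ) = t + 2 := by push_cast; rfl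
    have h1 := hs₁ (t + 2)
    have h2 := hs₂ (t + 2)
    have h3 := hs₃ (t + 2)
    have hg := hG (t + 2)
    rw [e1, show (t : ℤ) + 2 + 1 = t + 3 by ring] at h1 h2 h3
    rw [e1] at hg
    refine SmallOff.smallOn (G := levelPart G (t + 2)) (J := J (t + 2)) ?_ ?_ ?_ ?_ ?_ hg h1 h2 h3
    · intro x y z hx hy hz hs hm'
      have : |u x y z| ≤ M := by
        refine hoff x y z (by omega) (by omega) (by omega) (by omega) (by omega) (by omega)
          (by omega) (by omega) fun hxG => hm' ?_
        exact Finset.mem_filter.mpr ⟨hxG, hs⟩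
      refine this.trans ((hEM (t + 1)).trans ?_)
      exact le_mul_of_one_le_left (hE0 _) (by linarith)
    · exact mul_nonneg (by linarith) (hE0 _)
    · omega
    · intro x y z hx hy hz hs
      have h0 := hu x y z (by omega) (by omega) (by omega) (by omega) (by omega) (by omega)
        (by omega) (by omega)
      have hc := ih1 x y z (by omega) (by omega) (by omega) (by omega)
      have hp1 := (ih0 (x - 1) y z (by omega) (by omega) (by omega) (by omega)).trans (hEmono t)
      have hp2 := (ih0 x (y - 1) z (by omega) (by omega) (by omega) (by omega)).trans (hEmono t)
      have hp3 := (ih0 x y (z - 1) (by omega) (by omega) (by omega) (by omega)).trans (hEmono t)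
      have hc' := h0.trans (mul_le_mul_of_nonneg_left hc hκ)
      rw [nbrSum] at hc'
      rw [abs_le] at hc' hp1 hp2 hp3 ⊢
      constructor <;> linarith
    · linarith

lemma sum_card_levelPart_le (G : Finset (ℤ × ℤ × ℤ)) (P : ℕ → ℤ × ℤ × ℤ → Prop)
    [∀ t, DecidablePred (P t)] (Q : ℤ × ℤ × ℤ → Prop) [DecidablePred Q]
    (hPQ : ∀ t : ℕ, ∀ q : ℤ × ℤ × ℤ, q.1 + q.2.1 + q.2.2 = t → P t q → Q q) (n : ℕ) :
    ∑ t ∈ Finset.range n, ((levelPart G t).filter (P t)).card ≤ (G.filter Q).card := by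
  rw [← Finset.card_biUnion]
  · refine Finset.card_le_card fun q hq => ?_
    obtain ⟨t, _, hq⟩ := Finset.mem_biUnion.mp hq
    obtain ⟨hq, hP⟩ := Finset.mem_filter.mp hq
    obtain ⟨hq, hS⟩ := Finset.mem_filter.mp hq
    exact Finset.mem_filter.mpr ⟨hq, hPQ t q hS hP⟩
  · intro i _ j _ hij
    refine Finset.disjoint_left.mpr fun q hq hq' => hij ?_
    have h1 := (Finset.mem_filter.mp (Finset.mem_filter.mp hq).1).2
    have h2 := (Finset.mem_filter.mp (Finset.mem_filter.mp hq').1).2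
    omega

lemma log_natCast_le {m : ℕ} {μ : ℝ} (hμ : 1 ≤ μ) (hμm : μ ^ 40 = m) :
    Real.log m ≤ 20 * μ ^ 2 := by
  rw [← hμm, show μ ^ 40 = (μ ^ 2) ^ 20 by ring, Real.log_pow]
  have := Real.log_le_sub_one_of_pos (show 0 < μ ^ 2 by positivity)
  push_cast
  linarith

lemma nat_log_succ_le {m : ℕ} {μ : ℝ} (hμ : 1 ≤ μ) (hμm : μ ^ 40 = m) :
    ((Nat.log 2 m + 1 : ℕ) : ℝ) ≤ 41 * μ ^ 2 := by
  have hμ2 : 1 ≤ μ ^ 2 := one_le_pow₀ hμ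
  have hm : m ≠ 0 := by
    rintro rfl
    have : (0 : ℝ) < μ ^ 40 := by positivity
    simp [hμm] at this
  have h1 : ((2 ^ Nat.log 2 m : ℕ) : ℝ) ≤ m := by exact_mod_cast Nat.pow_log_le_self 2 hm
  have h2 := Real.log_le_log (by positivity) h1
  push_cast at h2
  rw [Real.log_pow] at h2
  have h3 := log_natCast_le hμ hμm
  have h4 := Real.log_two_gt_d9
  have h5 : (0 : ℝ) ≤ Nat.log 2 m := Nat.cast_nonneg _
  push_cast
  nlinarith

lemma log_level_le {m : ℕ} {μ : ℝ} (hμ : 1 ≤ μ) (hμm : μ ^ 40 = m) :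
    Real.log (4 * (192 * (m : ℝ) + 1)) ≤ 27 * μ ^ 2 := by
  have hμ2 : 1 ≤ μ ^ 2 := one_le_pow₀ hμ
  have hm : (1 : ℝ) ≤ m := by rw [← hμm]; exact one_le_pow₀ hμ
  have h1 : Real.log (4 * (192 * (m : ℝ) + 1)) ≤ Real.log (772 * m) :=
    Real.log_le_log (by positivity) (by linarith)
  rw [Real.log_mul (show (772 : ℝ) ≠ 0 by norm_num) (by positivity)] at h1
  have h2 : Real.log 772 ≤ 7 := by
    rw [Real.log_le_iff_le_exp (by norm_num)]
    have h3 : (2.7 : ℝ) ^ 7 ≤ exp 1 ^ 7 :=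
      pow_le_pow_left₀ (by norm_num) (by linarith [Real.exp_one_gt_d9]) 7
    rw [← Real.exp_nat_mul] at h3
    norm_num at h3 ⊢
    linarith
  linarith [log_natCast_le hμ hμm]

lemma climb {u : ℤ → ℤ → ℤ → ℝ} {κ M μ : ℝ} {m : ℕ} (hμ1 : 1 ≤ μ) (hμ : 58 ≤ μ ^ 3)
    (hμm : μ ^ 40 = m) (hκ : 0 ≤ κ) (hM : 0 ≤ M)
    (hu : ∀ x y z : ℤ, -20 * (m : ℤ) ≤ x → x ≤ 40 * m + 1 → -20 * (m : ℤ) ≤ y → y ≤ 40 * m + 1 →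
      -20 * (m : ℤ) ≤ z → z ≤ 40 * m + 1 → 1 ≤ x + y + z → x + y + z ≤ 40 * m - 1 →
      |nbrSum u x y z| ≤ κ * |u x y z|)
    (hbase : ∀ x y z : ℤ, -20 * (m : ℤ) ≤ x → x ≤ 40 * m + 1 → -20 * (m : ℤ) ≤ y →
      y ≤ 40 * m + 1 → -20 * (m : ℤ) ≤ z → z ≤ 40 * m + 1 → (x + y + z = 0 ∨ x + y + z = 1) →
      |u x y z| ≤ M)
    (G : Finset (ℤ × ℤ × ℤ)) (hGc : (G.card : ℝ) ≤ μ ^ 72)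
    (hoff : ∀ x y z : ℤ, -20 * (m : ℤ) ≤ x → x ≤ 40 * m + 1 → -20 * (m : ℤ) ≤ y →
      y ≤ 40 * m + 1 → -20 * (m : ℤ) ≤ z → z ≤ 40 * m + 1 → 0 ≤ x + y + z → x + y + z ≤ 40 * m →
      (x, y, z) ∉ G → |u x y z| ≤ M)
    (x y z : ℤ) (h0 : 0 ≤ x + y + z) (h1 : x + y + z ≤ 40 * m)
    (hx : (x + y + z + 1) / 2 - 18 * m ≤ x) (hy : (x + y + z + 1) / 2 - 18 * m ≤ y)
    (hz : (x + y + z + 1) / 2 - 18 * m ≤ z) :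
    |u x y z| ≤ M * exp ((4 * 10 ^ 9 + 40 * Real.log (κ + 3)) * μ ^ 60) := by
  have hpow1 : ∀ k, (1 : ℝ) ≤ μ ^ k := fun k => one_le_pow₀ hμ1
  have hmono : ∀ i j, i ≤ j → μ ^ i ≤ μ ^ j := fun i j h => pow_le_pow_right₀ hμ1 h
  have hm1 : 1 ≤ m := by
    have := hpow1 40
    rw [hμm] at this
    exact_mod_cast this
  obtain ⟨k, hk⟩ : ∃ k, k = G.card / (2 * m + 1) + 1 := ⟨_, rfl⟩
  have hkG : G.card ≤ (2 * m + 1) * k := by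
    rw [hk]
    exact (Nat.lt_mul_div_succ _ (by omega)).le
  have hkR : (k : ℝ) ≤ μ ^ 32 + 1 := by
    have h2 : (G.card / (2 * m + 1)) * m ≤ G.card := by
      have := Nat.div_mul_le_self G.card (2 * m + 1)
      nlinarith [Nat.zero_le (G.card / (2 * m + 1))]
    have h3 : ((G.card / (2 * m + 1) : ℕ) : ℝ) * μ ^ 40 ≤ μ ^ 32 * μ ^ 40 := by
      rw [← pow_add, hμm]
      refine le_trans ?_ hGc
      exact_mod_cast h2
    have h4 := le_of_mul_le_mul_right h3 (by positivity)
    rw [hk]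
    push_cast
    linarith
  obtain ⟨w₁, hw₁, hw₁', hc₁⟩ := exists_small_fibre G
    (fun q => q.1 - (q.1 + q.2.1 + q.2.2 + 1) / 2 + 20 * m) 0 (2 * m) k hkG
  obtain ⟨w₂, hw₂, hw₂', hc₂⟩ := exists_small_fibre G
    (fun q => q.2.1 - (q.1 + q.2.1 + q.2.2 + 1) / 2 + 20 * m) 0 (2 * m) k hkG
  obtain ⟨w₃, hw₃, hw₃', hc₃⟩ := exists_small_fibre G
    (fun q => q.2.2 - (q.1 + q.2.1 + q.2.2 + 1) / 2 + 20 * m) 0 (2 * m) k hkG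
  push_cast at hw₁' hw₂' hw₃'
  obtain ⟨n₁, hn₁⟩ : ∃ n₁ : ℕ → ℕ, ∀ t : ℕ, ((levelPart G t).filter
      (fun q => q.1 = ((t : ℤ) + 1) / 2 - 20 * m + w₁)).card = n₁ t := ⟨_, fun _ => rfl⟩
  obtain ⟨n₂, hn₂⟩ : ∃ n₂ : ℕ → ℕ, ∀ t : ℕ, ((levelPart G t).filter
      (fun q => q.2.1 = ((t : ℤ) + 1) / 2 - 20 * m + w₂)).card = n₂ t := ⟨_, fun _ => rfl⟩
  obtain ⟨n₃, hn₃⟩ : ∃ n₃ : ℕ → ℕ, ∀ t : ℕ, ((levelPart G t).filter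
      (fun q => q.2.2 = ((t : ℤ) + 1) / 2 - 20 * m + w₃)).card = n₃ t := ⟨_, fun _ => rfl⟩
  obtain ⟨N, hN⟩ : ∃ N : ℕ → ℕ, ∀ t : ℕ, (levelPart G t).card = N t := ⟨_, fun _ => rfl⟩
  have hsum₁ : ∀ n, ∑ t ∈ Finset.range n, n₁ t ≤ k := by
    intro n
    simp only [← hn₁]
    exact (sum_card_levelPart_le G _ _ (by intro t q h1 h2; rw [h1]; omega) n).trans hc₁
  have hsum₂ : ∀ n, ∑ t ∈ Finset.range n, n₂ t ≤ k := by
    intro n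
    simp only [← hn₂]
    exact (sum_card_levelPart_le G _ _ (by intro t q h1 h2; rw [h1]; omega) n).trans hc₂
  have hsum₃ : ∀ n, ∑ t ∈ Finset.range n, n₃ t ≤ k := by
    intro n
    simp only [← hn₃]
    exact (sum_card_levelPart_le G _ _ (by intro t q h1 h2; rw [h1]; omega) n).trans hc₃
  have hsumN : ∀ n, ∑ t ∈ Finset.range n, N t ≤ G.card := by
    intro n
    have := sum_card_levelPart_le G (fun _ _ => True) (fun _ => True) (fun _ _ _ _ => trivial) n
    simpa [hN] using this
  obtain ⟨l, hl⟩ : ∃ l, l = Nat.log 2 m + 1 := ⟨_, rfl⟩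
  have hlR : (l : ℝ) ≤ 41 * μ ^ 2 := by rw [hl]; exact nat_log_succ_le hμ1 hμm
  obtain ⟨X, hX⟩ : ∃ X : ℕ → ℕ, ∀ t, X t = n₁ t + n₂ t + n₃ t + Nat.sqrt (11 * l * N t) + 1 :=
    ⟨_, fun _ => rfl⟩
  have hsqrt : ∀ t, (Nat.sqrt (11 * l * N t) : ℝ) ≤ 451 * μ ^ 18 + N t / μ ^ 16 := by
    intro t
    have h2 : (Nat.sqrt (11 * l * N t) : ℝ) * Nat.sqrt (11 * l * N t) ≤ 11 * l * N t := by
      exact_mod_cast Nat.sqrt_le (11 * l * N t)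
    have h3 : (11 * l * N t : ℝ) ≤ (451 * μ ^ 18) * (N t / μ ^ 16) := by
      have : (451 * μ ^ 18) * (N t / μ ^ 16) = 11 * (41 * μ ^ 2) * N t := by
        field_simp
        ring
      rw [this]
      gcongr
    have h4 : 0 ≤ 451 * μ ^ 18 := by positivity
    have h5 : 0 ≤ N t / μ ^ 16 := by positivity
    by_contra! h6
    nlinarith
  have hXm : ∀ t, 2 * X t ≤ m := by
    intro t
    have e1 : (n₁ t : ℝ) ≤ k := by
      exact_mod_cast (Finset.single_le_sum (fun _ _ => Nat.zero_le _) (by simp)).trans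
        (hsum₁ (t + 1))
    have e2 : (n₂ t : ℝ) ≤ k := by
      exact_mod_cast (Finset.single_le_sum (fun _ _ => Nat.zero_le _) (by simp)).trans
        (hsum₂ (t + 1))
    have e3 : (n₃ t : ℝ) ≤ k := by
      exact_mod_cast (Finset.single_le_sum (fun _ _ => Nat.zero_le _) (by simp)).trans
        (hsum₃ (t + 1))
    have e4 : (N t : ℝ) ≤ μ ^ 72 := by
      refine le_trans ?_ hGc
      exact_mod_cast (Finset.single_le_sum (fun _ _ => Nat.zero_le _) (by simp)).trans
        (hsumN (t + 1))
    have e5 : (Nat.sqrt (11 * l * N t) : ℝ) ≤ 22 * μ ^ 37 := by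
      have h2 : (Nat.sqrt (11 * l * N t) : ℝ) * Nat.sqrt (11 * l * N t) ≤ 11 * l * N t := by
        exact_mod_cast Nat.sqrt_le (11 * l * N t)
      have h3 : (11 * l * N t : ℝ) ≤ 11 * (41 * μ ^ 2) * μ ^ 72 := by gcongr
      have h4 : (11 * (41 * μ ^ 2) * μ ^ 72 : ℝ) = 451 * (μ ^ 37 * μ ^ 37) := by ring
      have h5 := hpow1 37
      by_contra! h6
      nlinarith
    have h6 : (2 * X t : ℝ) ≤ m := by
      rw [← hμm, hX]
      push_cast
      have h7 : (μ : ℝ) ^ 40 = μ ^ 3 * μ ^ 37 := by ring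
      have h8 : 58 * μ ^ 37 ≤ μ ^ 3 * μ ^ 37 := mul_le_mul_of_nonneg_right hμ (by positivity)
      have h9 := hmono 32 37 (by norm_num)
      have h10 := hpow1 37
      linarith
    exact_mod_cast h6
  have hX1 : ∀ t, 1 ≤ X t := fun t => by rw [hX]; omega
  have hJX : ∀ t, X t ≤ 2 ^ Nat.clog 2 (X t) := fun t => Nat.le_pow_clog (by norm_num) _
  have hJX' : ∀ t, 2 ^ Nat.clog 2 (X t) ≤ 2 * X t := by
    intro t
    rcases (hX1 t).eq_or_lt with h | h
    · rw [← h]; simp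
    · have h2 := Nat.pow_pred_clog_lt_self (b := 2) (by norm_num) h
      have h3 : 0 < Nat.clog 2 (X t) := Nat.clog_pos (by norm_num) h
      obtain ⟨c, hc⟩ : ∃ c, Nat.clog 2 (X t) = c + 1 := ⟨_, (Nat.succ_pred_eq_of_pos h3).symm⟩
      rw [hc] at h2 ⊢
      rw [pow_succ]
      simp at h2
      omega
  obtain ⟨s, hs⟩ := Int.eq_ofNat_of_zero_le h0
  have hmain := climb_levels (A := 4 * (192 * (m : ℝ) + 1)) hm1 hκ hM hu hbase G hoff w₁ w₂ w₃
    ⟨hw₁, by omega⟩ ⟨hw₂, by omega⟩ ⟨hw₃, by omega⟩ (fun t => Nat.clog 2 (X t))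
    (fun t => (hJX' t).trans (hXm t)) le_rfl (by
      intro t
      rw [hN]
      have h2 : Nat.clog 2 (X t) + 1 ≤ l := by
        rw [hl]
        have := Nat.le_log_of_pow_le (b := 2) (by norm_num) ((hJX' t).trans (hXm t))
        omega
      have h3 : 11 * l * N t < (X t) ^ 2 := by
        refine (Nat.lt_succ_sqrt' (11 * l * N t)).trans_le (Nat.pow_le_pow_left ?_ 2)
        rw [hX]
        omega
      have h4 : (X t) ^ 2 ≤ (2 ^ Nat.clog 2 (X t)) ^ 2 := Nat.pow_le_pow_left (hJX t) 2
      have h5 : (Nat.clog 2 (X t) + 1) * N t ≤ l * N t := Nat.mul_le_mul_right _ h2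
      nlinarith)
    (fun t => by rw [hn₁]; have := hJX t; have := hX t; omega)
    (fun t => by rw [hn₂]; have := hJX t; have := hX t; omega)
    (fun t => by rw [hn₃]; have := hJX t; have := hX t; omega) s (by omega)
  refine (hmain x y z (by omega) (by omega) (by omega) hs).trans ?_
  rw [mul_assoc]
  refine mul_le_mul_of_nonneg_left ?_ hM
  have hsR : (s : ℝ) ≤ 40 * μ ^ 40 := by
    rw [hμm]
    exact_mod_cast (by omega : s ≤ 40 * m)
  have hlogκ : 0 ≤ Real.log (κ + 3) := Real.log_nonneg (by linarith)
  have hA1 : (1 : ℝ) ≤ 4 * (192 * (m : ℝ) + 1) := by linarith [m.cast_nonneg (α := ℝ)]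
  have hlogA := log_level_le hμ1 hμm
  have hsumX : ((∑ i ∈ Finset.range (s + 1), 2 ^ Nat.clog 2 (X i) : ℕ) : ℝ) ≤ 37080 * μ ^ 58 := by
    have b1 : ((∑ i ∈ Finset.range (s + 1), 2 ^ Nat.clog 2 (X i) : ℕ) : ℝ) ≤
        2 * ∑ i ∈ Finset.range (s + 1), (X i : ℝ) := by
      rw [Finset.mul_sum]
      push_cast
      refine Finset.sum_le_sum fun i _ => ?_
      exact_mod_cast hJX' i
    have b2 : ∑ i ∈ Finset.range (s + 1), (X i : ℝ) ≤
        ∑ i ∈ Finset.range (s + 1),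
          ((n₁ i : ℝ) + n₂ i + n₃ i + (451 * μ ^ 18 + N i / μ ^ 16) + 1) := by
      refine Finset.sum_le_sum fun i _ => ?_
      rw [hX]
      push_cast
      linarith [hsqrt i]
    have c1 : ∑ i ∈ Finset.range (s + 1), (n₁ i : ℝ) ≤ k := by exact_mod_cast hsum₁ (s + 1)
    have c2 : ∑ i ∈ Finset.range (s + 1), (n₂ i : ℝ) ≤ k := by exact_mod_cast hsum₂ (s + 1)
    have c3 : ∑ i ∈ Finset.range (s + 1), (n₃ i : ℝ) ≤ k := by exact_mod_cast hsum₃ (s + 1)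
    have c4 : ∑ i ∈ Finset.range (s + 1), (N i : ℝ) ≤ μ ^ 72 := by
      refine le_trans ?_ hGc
      exact_mod_cast hsumN (s + 1)
    have c5 : (∑ i ∈ Finset.range (s + 1), (N i : ℝ)) / μ ^ 16 ≤ μ ^ 56 := by
      rw [div_le_iff₀ (by positivity), ← pow_add]
      exact c4
    simp only [Finset.sum_add_distrib, ← Finset.sum_div, Finset.sum_const, Finset.card_range,
      nsmul_eq_mul] at b2
    push_cast at b2
    have d1 : ((s : ℝ) + 1) * (451 * μ ^ 18) ≤ 41 * μ ^ 40 * (451 * μ ^ 18) := by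
      refine mul_le_mul_of_nonneg_right ?_ (by positivity)
      linarith [hpow1 40]
    have d2 : 41 * μ ^ 40 * (451 * μ ^ 18) = 18491 * μ ^ 58 := by ring
    have d3 := hmono 32 58 (by norm_num)
    have d4 := hmono 56 58 (by norm_num)
    have d5 := hmono 40 58 (by norm_num)
    have d6 := hpow1 58
    linarith
  calc (κ + 3) ^ s * (4 * (192 * (m : ℝ) + 1)) ^
        (3060 * ∑ i ∈ Finset.range (s + 1), 2 ^ Nat.clog 2 (X i))
      = exp (s * Real.log (κ + 3) + ((3060 * ∑ i ∈ Finset.range (s + 1), 2 ^ Nat.clog 2 (X i) : ℕ) : ℝ)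
          * Real.log (4 * (192 * (m : ℝ) + 1))) := by
        rw [exp_add, ← Real.log_pow, ← Real.log_pow, exp_log (by positivity), exp_log (by positivity)]
    _ ≤ exp ((4 * 10 ^ 9 + 40 * Real.log (κ + 3)) * μ ^ 60) := by
        apply exp_le_exp.mpr
        rw [add_mul, add_comm]
        refine add_le_add ?_ ?_
        · rw [Nat.cast_mul]
          calc ((3060 : ℕ) : ℝ) * ((∑ i ∈ Finset.range (s + 1), 2 ^ Nat.clog 2 (X i) : ℕ) : ℝ) *
                Real.log (4 * (192 * (m : ℝ) + 1))
              ≤ (3060 * (37080 * μ ^ 58)) * (27 * μ ^ 2) := by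
                refine mul_le_mul ?_ hlogA (Real.log_nonneg hA1) (by positivity)
                push_cast at hsumX ⊢
                linarith
            _ = 3063549600 * μ ^ 60 := by ring
            _ ≤ _ := by
                have := hpow1 60
                nlinarith
        · rw [mul_comm 40, mul_assoc, mul_comm]
          refine mul_le_mul_of_nonneg_left (hsR.trans ?_) hlogκ
          linarith [hmono 40 60 (by norm_num)]

/-- The neighbour sum of `u` is dominated by `κ |u|` on the cube of radius `R`. -/
def NbrBound (κ : ℝ) (u : ℤ → ℤ → ℤ → ℝ) (R : ℤ) : Prop :=
  ∀ x y z, |x| ≤ R → |y| ≤ R → |z| ≤ R → |nbrSum u x y z| ≤ κ * |u x y z|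

/-- `|u| ≤ M` on the cube of radius `ρ`. -/
def CubeBound (M : ℝ) (u : ℤ → ℤ → ℤ → ℝ) (ρ : ℤ) : Prop :=
  ∀ x y z, |x| ≤ ρ → |y| ≤ ρ → |z| ≤ ρ → |u x y z| ≤ M

/-- `|u| ≤ M` on the cube of radius `R` outside a set of at most `N` points. -/
def FewLarge (N M : ℝ) (u : ℤ → ℤ → ℤ → ℝ) (R : ℤ) : Prop :=
  ∃ G : Finset (ℤ × ℤ × ℤ), (G.card : ℝ) ≤ N ∧
    ∀ x y z, |x| ≤ R → |y| ≤ R → |z| ≤ R → (x, y, z) ∉ G → |u x y z| ≤ M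

lemma NbrBound.swap12 {κ : ℝ} {u : ℤ → ℤ → ℤ → ℝ} {R : ℤ} (h : NbrBound κ u R) :
    NbrBound κ (fun x y z => u y x z) R := by
  intro x y z hx hy hz
  have := h y x z hy hx hz
  simp only [nbrSum] at this ⊢
  convert this using 2
  ring

lemma NbrBound.swap23 {κ : ℝ} {u : ℤ → ℤ → ℤ → ℝ} {R : ℤ} (h : NbrBound κ u R) :
    NbrBound κ (fun x y z => u x z y) R := by
  intro x y z hx hy hz
  have := h x z y hx hz hy
  simp only [nbrSum] at this ⊢
  convert this using 2
  ring

lemma NbrBound.neg1 {κ : ℝ} {u : ℤ → ℤ → ℤ → ℝ} {R : ℤ} (h : NbrBound κ u R) :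
    NbrBound κ (fun x y z => u (-x) y z) R := by
  intro x y z hx hy hz
  have := h (-x) y z (by rwa [abs_neg]) hy hz
  simp only [nbrSum] at this ⊢
  rw [show -(x + 1) = -x - 1 by ring, show -(x - 1) = -x + 1 by ring]
  convert this using 2
  ring

lemma FewLarge.comp {N M : ℝ} {u : ℤ → ℤ → ℤ → ℝ} {R : ℤ} (h : FewLarge N M u R)
    (σ : ℤ × ℤ × ℤ → ℤ × ℤ × ℤ) (hσ : ∀ p, σ (σ p) = p)
    (hR : ∀ p : ℤ × ℤ × ℤ, |p.1| ≤ R → |p.2.1| ≤ R → |p.2.2| ≤ R →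
      |(σ p).1| ≤ R ∧ |(σ p).2.1| ≤ R ∧ |(σ p).2.2| ≤ R) :
    FewLarge N M (fun x y z => u (σ (x, y, z)).1 (σ (x, y, z)).2.1 (σ (x, y, z)).2.2) R := by
  obtain ⟨G, hG, h⟩ := h
  refine ⟨G.image σ, le_trans (by exact_mod_cast Finset.card_image_le) hG, ?_⟩
  intro x y z hx hy hz hm
  obtain ⟨h1, h2, h3⟩ := hR (x, y, z) hx hy hz
  exact h _ _ _ h1 h2 h3 fun hmem => hm (Finset.mem_image.mpr ⟨_, hmem, hσ _⟩)

/-- The hypotheses under which smallness propagates from the cube of radius `ρ`. -/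
structure GrowData (κ M N : ℝ) (ρ R : ℤ) (u : ℤ → ℤ → ℤ → ℝ) : Prop where
  nbr : NbrBound κ u R
  cube : CubeBound M u ρ
  few : FewLarge N M u R

lemma GrowData.swap12 {κ M N : ℝ} {ρ R : ℤ} {u : ℤ → ℤ → ℤ → ℝ} (h : GrowData κ M N ρ R u) :
    GrowData κ M N ρ R (fun x y z => u y x z) :=
  ⟨h.nbr.swap12, fun x y z hx hy hz => h.cube y x z hy hx hz,
    h.few.comp (fun p => (p.2.1, p.1, p.2.2)) (fun _ => rfl) fun _ h1 h2 h3 => ⟨h2, h1, h3⟩⟩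

lemma GrowData.swap23 {κ M N : ℝ} {ρ R : ℤ} {u : ℤ → ℤ → ℤ → ℝ} (h : GrowData κ M N ρ R u) :
    GrowData κ M N ρ R (fun x y z => u x z y) :=
  ⟨h.nbr.swap23, fun x y z hx hy hz => h.cube x z y hx hz hy,
    h.few.comp (fun p => (p.1, p.2.2, p.2.1)) (fun _ => rfl) fun _ h1 h2 h3 => ⟨h1, h3, h2⟩⟩

lemma GrowData.neg1 {κ M N : ℝ} {ρ R : ℤ} {u : ℤ → ℤ → ℤ → ℝ} (h : GrowData κ M N ρ R u) :
    GrowData κ M N ρ R (fun x y z => u (-x) y z) :=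
  ⟨h.nbr.neg1, fun x y z hx hy hz => h.cube (-x) y z (by rwa [abs_neg]) hy hz,
    h.few.comp (fun p => (-p.1, p.2.1, p.2.2)) (fun p => by simp)
      fun _ h1 h2 h3 => ⟨by simpa using h1, h2, h3⟩⟩

lemma CubeBound.pyramid {κ M : ℝ} {u : ℤ → ℤ → ℤ → ℝ} {ρ R : ℤ} (hκ : 0 ≤ κ) (hM : 0 ≤ M)
    (hρ : 1 ≤ ρ) (hu : NbrBound κ u R) (hc : CubeBound M u ρ) (k : ℕ) (hk : ρ + k ≤ R)
    (x y z : ℤ) (hx : -ρ ≤ x) (hxk : x ≤ ρ + k) (hy : |y| ≤ ρ) (hz : |z| ≤ ρ)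
    (hxy : x + |y| ≤ 2 * ρ) (hxz : x + |z| ≤ 2 * ρ) :
    |u x y z| ≤ (κ + 5) ^ k * M := by
  induction k generalizing x y z with
  | zero =>
    simpa using hc x y z (abs_le.mpr ⟨by omega, by omega⟩) hy hz
  | succ k ih =>
    have hle : (κ + 5) ^ k * M ≤ (κ + 5) ^ (k + 1) * M :=
      mul_le_mul_of_nonneg_right (pow_le_pow_right₀ (by linarith) (by omega)) hM
    by_cases hxk' : x ≤ ρ + k
    · exact (ih (by omega) x y z hx hxk' hy hz hxy hxz).trans hle
    · simp only [abs_le] at hy hz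
      have hy' : -(2 * ρ - x) ≤ y ∧ y ≤ 2 * ρ - x := abs_le.mp (by omega)
      have hz' : -(2 * ρ - x) ≤ z ∧ z ≤ 2 * ρ - x := abs_le.mp (by omega)
      have hI : ∀ x' y' z' : ℤ, -ρ ≤ x' → x' < x → -ρ ≤ y' → y' ≤ ρ → -ρ ≤ z' → z' ≤ ρ →
          x' + y' ≤ 2 * ρ → x' - y' ≤ 2 * ρ → x' + z' ≤ 2 * ρ → x' - z' ≤ 2 * ρ →
          |u x' y' z'| ≤ (κ + 5) ^ k * M := by
        intro x' y' z' h1 h2 h3 h4 h5 h6 h7 h8 h9 h10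
        refine ih (by omega) x' y' z' h1 (by push_cast at hxk; omega) (abs_le.mpr ⟨h3, h4⟩)
          (abs_le.mpr ⟨h5, h6⟩) ?_ ?_
        · rcases abs_cases y' with h | h <;> omega
        · rcases abs_cases z' with h | h <;> omega
      have h0 := hI (x - 1) y z (by omega) (by omega) (by omega) (by omega) (by omega) (by omega)
        (by omega) (by omega) (by omega) (by omega)
      have h1 := hI (x - 1 - 1) y z (by omega) (by omega) (by omega) (by omega) (by omega)
        (by omega) (by omega) (by omega) (by omega) (by omega)
      have h2 := hI (x - 1) (y + 1) z (by omega) (by omega) (by omega) (by omega) (by omega)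
        (by omega) (by omega) (by omega) (by omega) (by omega)
      have h3 := hI (x - 1) (y - 1) z (by omega) (by omega) (by omega) (by omega) (by omega)
        (by omega) (by omega) (by omega) (by omega) (by omega)
      have h4 := hI (x - 1) y (z + 1) (by omega) (by omega) (by omega) (by omega) (by omega)
        (by omega) (by omega) (by omega) (by omega) (by omega)
      have h5 := hI (x - 1) y (z - 1) (by omega) (by omega) (by omega) (by omega) (by omega)
        (by omega) (by omega) (by omega) (by omega) (by omega)
      have h6 := hu (x - 1) y z (abs_le.mpr ⟨by omega, by push_cast at hk hxk; omega⟩)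
        (abs_le.mpr ⟨by omega, by omega⟩) (abs_le.mpr ⟨by omega, by omega⟩)
      have h7 := h6.trans (mul_le_mul_of_nonneg_left h0 hκ)
      rw [nbrSum, show x - 1 + 1 = x by ring] at h7
      rw [pow_succ]
      rw [abs_le] at h1 h2 h3 h4 h5 h7 ⊢
      constructor <;> linarith

/-- The loss in enlarging a small cube by `μ ^ 40`. -/
noncomputable def growLoss (κ μ : ℝ) (m : ℕ) : ℝ :=
  (κ + 5) ^ (30 * m) * exp ((4 * 10 ^ 9 + 40 * Real.log (κ + 3)) * μ ^ 60)

lemma one_le_growLoss {κ μ : ℝ} (hκ : 0 ≤ κ) (hμ : 1 ≤ μ) (m : ℕ) : 1 ≤ growLoss κ μ m := by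
  have h1 : 0 ≤ Real.log (κ + 3) := Real.log_nonneg (by linarith)
  exact one_le_mul_of_one_le_of_one_le (one_le_pow₀ (by linarith))
    (Real.one_le_exp (by positivity))

lemma GrowData.bound_sorted {κ M μ : ℝ} {ρ R : ℤ} {m : ℕ} {u : ℤ → ℤ → ℤ → ℝ}
    (h : GrowData κ M (μ ^ 72) ρ R u) (hμ1 : 1 ≤ μ) (hμ : 58 ≤ μ ^ 3)
    (hμm : μ ^ 40 = m) (hκ : 0 ≤ κ) (hM : 0 ≤ M) (hρ : 61 * m + 1 ≤ ρ) (hR : ρ + 30 * m ≤ R)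
    (x y z : ℤ) (hx : x ≤ ρ + m) (hxy : y ≤ x) (hyz : z ≤ y) (hz : 0 ≤ z) :
    |u x y z| ≤ M * growLoss κ μ m := by
  have hm1 : 1 ≤ m := by
    have := one_le_pow₀ hμ1 (n := 40)
    rw [hμm] at this
    exact_mod_cast this
  have hlog : 0 ≤ Real.log (κ + 3) := Real.log_nonneg (by linarith)
  have hκ5 : 1 ≤ κ + 5 := by linarith
  by_cases hy : y ≤ ρ - m
  · have h1 := h.cube.pyramid hκ hM (by omega) h.nbr m (by omega) x y z (by omega) (by omega)
      (abs_le.mpr ⟨by omega, by omega⟩) (abs_le.mpr ⟨by omega, by omega⟩)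
      (by rw [abs_of_nonneg (by omega)]; omega) (by rw [abs_of_nonneg (by omega)]; omega)
    refine h1.trans ?_
    rw [mul_comm, growLoss]
    refine mul_le_mul_of_nonneg_left ?_ hM
    calc (κ + 5) ^ m ≤ (κ + 5) ^ (30 * m) := pow_le_pow_right₀ hκ5 (by omega)
      _ ≤ _ := le_mul_of_one_le_right (by positivity) (Real.one_le_exp (by positivity))
  obtain ⟨ζ, hζ⟩ : ∃ ζ, ζ = min z ρ := ⟨_, rfl⟩
  have hζ' : 0 ≤ ζ ∧ ζ ≤ ρ ∧ ζ ≤ z ∧ z - ζ ≤ m := by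
    rcases min_cases z ρ with h | h <;> omega
  clear hζ
  set v : ℤ → ℤ → ℤ → ℝ := fun x y z =>
    u (x + (ρ - 12 * m)) (y + (ρ - 12 * m)) (z + (ζ - 12 * m)) with hv
  obtain ⟨G, hGc, hG⟩ := h.few
  set G' := G.image (fun p => (p.1 - (ρ - 12 * (m : ℤ)), p.2.1 - (ρ - 12 * (m : ℤ)),
    p.2.2 - (ζ - 12 * (m : ℤ)))) with hG'
  have hMle : M ≤ (κ + 5) ^ (30 * m) * M := le_mul_of_one_le_left hM (one_le_pow₀ hκ5)
  have key := climb (u := v) (M := (κ + 5) ^ (30 * m) * M) hμ1 hμ hμm hκ (by positivity)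
    (by
      intro x y z h1 h2 h3 h4 h5 h6 _ _
      have := h.nbr (x + (ρ - 12 * m)) (y + (ρ - 12 * m)) (z + (ζ - 12 * m))
        (abs_le.mpr ⟨by omega, by omega⟩) (abs_le.mpr ⟨by omega, by omega⟩)
        (abs_le.mpr ⟨by omega, by omega⟩)
      simp only [hv, nbrSum] at this ⊢
      rwa [show x + (ρ - 12 * (m : ℤ)) + 1 = x + 1 + (ρ - 12 * m) by ring,
        show x + (ρ - 12 * (m : ℤ)) - 1 = x - 1 + (ρ - 12 * m) by ring,
        show y + (ρ - 12 * (m : ℤ)) + 1 = y + 1 + (ρ - 12 * m) by ring,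
        show y + (ρ - 12 * (m : ℤ)) - 1 = y - 1 + (ρ - 12 * m) by ring,
        show z + (ζ - 12 * (m : ℤ)) + 1 = z + 1 + (ζ - 12 * m) by ring,
        show z + (ζ - 12 * (m : ℤ)) - 1 = z - 1 + (ζ - 12 * m) by ring] at this)
    (by
      intro x y z h1 h2 h3 h4 h5 h6 hs
      simp only [hv]
      obtain ⟨X, hX⟩ : ∃ X, X = x + (ρ - 12 * (m : ℤ)) := ⟨_, rfl⟩
      obtain ⟨Y, hY⟩ : ∃ Y, Y = y + (ρ - 12 * (m : ℤ)) := ⟨_, rfl⟩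
      obtain ⟨Z, hZ⟩ : ∃ Z, Z = z + (ζ - 12 * (m : ℤ)) := ⟨_, rfl⟩
      rw [← hX, ← hY, ← hZ]
      by_cases hXρ : ρ < X
      · refine h.cube.pyramid hκ hM (by omega) h.nbr (30 * m) (by omega) X Y Z (by omega)
          (by omega) (abs_le.mpr ⟨by omega, by omega⟩) (abs_le.mpr ⟨by omega, by omega⟩) ?_ ?_
        · rcases abs_cases Y with h | h <;> omega
        · rcases abs_cases Z with h | h <;> omega
      by_cases hYρ : ρ < Y
      · refine h.swap12.cube.pyramid hκ hM (by omega) h.swap12.nbr (30 * m) (by omega) Y X Z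
          (by omega) (by omega) (abs_le.mpr ⟨by omega, by omega⟩)
          (abs_le.mpr ⟨by omega, by omega⟩) ?_ ?_
        · rcases abs_cases X with h | h <;> omega
        · rcases abs_cases Z with h | h <;> omega
      by_cases hZρ : ρ < Z
      · refine h.swap23.swap12.cube.pyramid hκ hM (by omega) h.swap23.swap12.nbr (30 * m)
          (by omega) Z X Y (by omega) (by omega) (abs_le.mpr ⟨by omega, by omega⟩)
          (abs_le.mpr ⟨by omega, by omega⟩) ?_ ?_
        · rcases abs_cases X with h | h <;> omega
        · rcases abs_cases Y with h | h <;> omega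
      exact (h.cube X Y Z (abs_le.mpr ⟨by omega, by omega⟩) (abs_le.mpr ⟨by omega, by omega⟩)
        (abs_le.mpr ⟨by omega, by omega⟩)).trans hMle)
    G' (le_trans (by exact_mod_cast Finset.card_image_le) hGc)
    (by
      intro x y z h1 h2 h3 h4 h5 h6 _ _ hm'
      refine (hG _ _ _ (abs_le.mpr ⟨by omega, by omega⟩) (abs_le.mpr ⟨by omega, by omega⟩)
        (abs_le.mpr ⟨by omega, by omega⟩) fun hmem => hm' ?_).trans hMle
      exact Finset.mem_image.mpr ⟨_, hmem, by simp⟩)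
    (x - (ρ - 12 * m)) (y - (ρ - 12 * m)) (z - (ζ - 12 * m))
    (by omega) (by omega) (by omega) (by omega) (by omega)
  simp only [hv, sub_add_cancel] at key
  refine key.trans (le_of_eq ?_)
  rw [growLoss]
  ring

lemma GrowData.cubeBound {κ M μ : ℝ} {ρ R : ℤ} {m : ℕ} {u : ℤ → ℤ → ℤ → ℝ}
    (h : GrowData κ M (μ ^ 72) ρ R u) (hμ1 : 1 ≤ μ) (hμ : 58 ≤ μ ^ 3)
    (hμm : μ ^ 40 = m) (hκ : 0 ≤ κ) (hM : 0 ≤ M) (hρ : 61 * m + 1 ≤ ρ) (hR : ρ + 30 * m ≤ R) :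
    CubeBound (M * growLoss κ μ m) u (ρ + m) := by
  have hpos : ∀ v, GrowData κ M (μ ^ 72) ρ R v → ∀ x y z : ℤ, 0 ≤ x → 0 ≤ y → 0 ≤ z →
      x ≤ ρ + m → y ≤ ρ + m → z ≤ ρ + m → |v x y z| ≤ M * growLoss κ μ m := by
    intro v hv x y z hx hy hz hx' hy' hz'
    rcases le_total x y with hxy | hxy <;> rcases le_total y z with hyz | hyz <;>
      rcases le_total x z with hxz | hxz
    · exact hv.swap12.swap23.swap12.bound_sorted hμ1 hμ hμm hκ hM hρ hR z y x hz' hyz hxy hx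
    · exact hv.swap12.swap23.swap12.bound_sorted hμ1 hμ hμm hκ hM hρ hR z y x hz' hyz hxy hx
    · exact hv.swap12.swap23.bound_sorted hμ1 hμ hμm hκ hM hρ hR y z x hy' hyz hxz hx
    · exact hv.swap12.bound_sorted hμ1 hμ hμm hκ hM hρ hR y x z hy' hxy hxz hz
    · exact hv.swap23.swap12.bound_sorted hμ1 hμ hμm hκ hM hρ hR z x y hz' hxz hxy hy
    · exact hv.swap23.bound_sorted hμ1 hμ hμm hκ hM hρ hR x z y hx' hxz hyz hy
    · exact hv.bound_sorted hμ1 hμ hμm hκ hM hρ hR x y z hx' hxy hyz hz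
    · exact hv.bound_sorted hμ1 hμ hμm hκ hM hρ hR x y z hx' hxy hyz hz
  have hpos2 : ∀ v, GrowData κ M (μ ^ 72) ρ R v → ∀ x y z : ℤ, 0 ≤ y → 0 ≤ z →
      |x| ≤ ρ + m → y ≤ ρ + m → z ≤ ρ + m → |v x y z| ≤ M * growLoss κ μ m := by
    intro v hv x y z hy hz hx' hy' hz'
    rw [abs_le] at hx'
    rcases le_total 0 x with hx | hx
    · exact hpos v hv x y z hx hy hz hx'.2 hy' hz'
    · simpa using hpos _ hv.neg1 (-x) y z (by omega) hy hz (by omega) hy' hz'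
  have hpos3 : ∀ v, GrowData κ M (μ ^ 72) ρ R v → ∀ x y z : ℤ, 0 ≤ z →
      |x| ≤ ρ + m → |y| ≤ ρ + m → z ≤ ρ + m → |v x y z| ≤ M * growLoss κ μ m := by
    intro v hv x y z hz hx' hy' hz'
    rw [abs_le] at hy'
    rcases le_total 0 y with hy | hy
    · exact hpos2 v hv x y z hy hz hx' hy'.2 hz'
    · simpa using hpos2 _ hv.swap12.neg1.swap12 x (-y) z (by omega) hz hx' (by omega) hz'
  intro x y z hx' hy' hz'
  rw [abs_le] at hz'
  rcases le_total 0 z with hz | hz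
  · exact hpos3 u h x y z hz hx' hy' hz'.2
  · simpa using hpos3 _ h.swap23.swap12.neg1.swap12.swap23 x y (-z) (by omega) hx' hy' (by omega)

lemma GrowData.cubeBound_iterate {κ M μ : ℝ} {ρ R : ℤ} {m : ℕ} {u : ℤ → ℤ → ℤ → ℝ}
    (h : GrowData κ M (μ ^ 72) ρ R u) (hμ1 : 1 ≤ μ) (hμ : 58 ≤ μ ^ 3)
    (hμm : μ ^ 40 = m) (hκ : 0 ≤ κ) (hM : 0 ≤ M) (hρ : 61 * m + 1 ≤ ρ) (i : ℕ)
    (hR : ρ + i * m + 30 * m ≤ R) :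
    CubeBound (M * growLoss κ μ m ^ i) u (ρ + i * m) := by
  have h1 := one_le_growLoss hκ hμ1 m
  induction i with
  | zero => simpa using h.cube
  | succ i ih =>
    push_cast at hR ⊢
    have hM' : 0 ≤ M * growLoss κ μ m ^ i := by positivity
    have hle : M ≤ M * growLoss κ μ m ^ i := le_mul_of_one_le_right hM (one_le_pow₀ h1)
    have hnn : (0 : ℤ) ≤ i * m := by positivity
    have hd : GrowData κ (M * growLoss κ μ m ^ i) (μ ^ 72) (ρ + i * m) R u := by
      refine ⟨h.nbr, ih (by linarith), ?_⟩
      obtain ⟨G, hGc, hG⟩ := h.few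
      exact ⟨G, hGc, fun x y z hx hy hz hm => (hG x y z hx hy hz hm).trans hle⟩
    have := hd.cubeBound hμ1 hμ hμm hκ hM' (by linarith) (by linarith)
    rw [pow_succ, ← mul_assoc]
    rwa [show ρ + ((i : ℤ) + 1) * m = ρ + i * m + m by ring]

lemma NbrBound.shift {κ : ℝ} {u : ℤ → ℤ → ℤ → ℝ} {R R' : ℤ} (h : NbrBound κ u R) (a b c : ℤ)
    (ha : |a| + R' ≤ R) (hb : |b| + R' ≤ R) (hc : |c| + R' ≤ R) :
    NbrBound κ (fun x y z => u (x + a) (y + b) (z + c)) R' := by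
  intro x y z hx hy hz
  have := h (x + a) (y + b) (z + c) ((abs_add_le _ _).trans (by omega))
    ((abs_add_le _ _).trans (by omega)) ((abs_add_le _ _).trans (by omega))
  simp only [nbrSum] at this ⊢
  rwa [add_right_comm x a 1, add_sub_right_comm x a 1, add_right_comm y b 1,
    add_sub_right_comm y b 1, add_right_comm z c 1, add_sub_right_comm z c 1] at this

/-- A set of points of the cube of radius `r` at which `|u| ≥ δ`. -/
def LargeIn (u : ℤ → ℤ → ℤ → ℝ) (r : ℤ) (δ : ℝ) (F : Finset (ℤ × ℤ × ℤ)) : Prop :=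
  ∀ p ∈ F, |p.1| ≤ r ∧ |p.2.1| ≤ r ∧ |p.2.2| ≤ r ∧ δ ≤ |u p.1 p.2.1 p.2.2|

/-- The cube of radius `r` as a finite set of triples. -/
noncomputable def cubeFinset (r : ℕ) : Finset (ℤ × ℤ × ℤ) :=
  Finset.Icc (-(r : ℤ)) r ×ˢ Finset.Icc (-(r : ℤ)) r ×ˢ Finset.Icc (-(r : ℤ)) r

lemma mem_cubeFinset {r : ℕ} {p : ℤ × ℤ × ℤ} :
    p ∈ cubeFinset r ↔ |p.1| ≤ (r : ℤ) ∧ |p.2.1| ≤ (r : ℤ) ∧ |p.2.2| ≤ (r : ℤ) := by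
  simp [cubeFinset, abs_le]

lemma card_cubeFinset (r : ℕ) : (cubeFinset r).card = (2 * r + 1) ^ 3 := by
  simp only [cubeFinset, Finset.card_product, Int.card_Icc,
    show ((r : ℤ) + 1 - -r).toNat = 2 * r + 1 by omega]
  ring

/-- The constant in the exponent of the decay bound over a cube. -/
noncomputable def decayConst (κ : ℝ) : ℝ :=
  35000 * (30 * Real.log (κ + 5) + (4 * 10 ^ 9 + 40 * Real.log (κ + 3))) + 1

lemma decayConst_pos {κ : ℝ} (hκ : 0 ≤ κ) : 0 < decayConst κ := by
  have h1 : 0 ≤ Real.log (κ + 3) := Real.log_nonneg (by linarith)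
  have h2 : 0 ≤ Real.log (κ + 5) := Real.log_nonneg (by linarith)
  unfold decayConst
  positivity

lemma growLoss_pow_lt {κ μ : ℝ} {m r : ℕ} (hκ : 0 ≤ κ) (hμ : 1 ≤ μ) (hμm : μ ^ 40 = m)
    (hmr : m ≤ r) : growLoss κ μ m ^ 35000 < exp (decayConst κ * (r : ℝ) ^ (3 / 2 : ℝ)) := by
  have h1 : 0 ≤ Real.log (κ + 3) := Real.log_nonneg (by linarith)
  have h2 : 0 ≤ Real.log (κ + 5) := Real.log_nonneg (by linarith)
  have hm1 : (1 : ℝ) ≤ m := by rw [← hμm]; exact one_le_pow₀ hμ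
  have hmrR : (m : ℝ) ≤ r := by exact_mod_cast hmr
  have hμr : μ ^ 60 ≤ (r : ℝ) ^ (3 / 2 : ℝ) := by
    have : μ ^ 60 = (m : ℝ) ^ (3 / 2 : ℝ) := by
      rw [← hμm, ← Real.rpow_natCast μ 40, ← Real.rpow_mul (by linarith),
        ← Real.rpow_natCast μ 60]
      norm_num
    rw [this]
    exact Real.rpow_le_rpow (by positivity) hmrR (by norm_num)
  have hmr' : (m : ℝ) ≤ (r : ℝ) ^ (3 / 2 : ℝ) := by
    refine hmrR.trans ?_
    exact Real.self_le_rpow_of_one_le (by linarith) (by norm_num)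
  have h3 : growLoss κ μ m = exp (30 * m * Real.log (κ + 5) +
      (4 * 10 ^ 9 + 40 * Real.log (κ + 3)) * μ ^ 60) := by
    rw [growLoss, exp_add]
    congr 1
    rw [show (30 : ℝ) * m = ((30 * m : ℕ) : ℝ) by push_cast; rfl, ← Real.log_pow,
      exp_log (by positivity)]
  rw [h3, ← Real.exp_nat_mul]
  apply exp_lt_exp.mpr
  unfold decayConst
  push_cast
  have h4 : (m : ℝ) * Real.log (κ + 5) ≤ (r : ℝ) ^ (3 / 2 : ℝ) * Real.log (κ + 5) :=
    mul_le_mul_of_nonneg_right hmr' h2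
  have h5 := mul_le_mul_of_nonneg_left hμr
    (show 0 ≤ 4 * 10 ^ 9 + 40 * Real.log (κ + 3) by positivity)
  nlinarith

lemma exists_large_near {κ μ δ : ℝ} {m r : ℕ} {u : ℤ → ℤ → ℤ → ℝ} (hκ : 0 ≤ κ) (hμ1 : 1 ≤ μ)
    (hμ : 58 ≤ μ ^ 3) (hμm : μ ^ 40 = m) (hmr : 140000 * m ≤ r) (hu : NbrBound κ u r)
    (hu0 : u 0 0 0 ≠ 0)
    (hδ : δ = exp (-(decayConst κ * (r : ℝ) ^ (3 / 2 : ℝ))) * |u 0 0 0|)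
    (hfew : FewLarge (μ ^ 72) δ u r) (a b c : ℤ) (ha : |a| ≤ 35000 * m) (hb : |b| ≤ 35000 * m)
    (hc : |c| ≤ 35000 * m) :
    ∃ x y z : ℤ, |x| ≤ 62 * m ∧ |y| ≤ 62 * m ∧ |z| ≤ 62 * m ∧
      δ < |u (x + a) (y + b) (z + c)| := by
  by_contra! hcon
  have hm1 : 1 ≤ m := by
    have := one_le_pow₀ hμ1 (n := 40)
    rw [hμm] at this
    exact_mod_cast this
  have hδ0 : 0 ≤ δ := by rw [hδ]; positivity
  have hd : GrowData κ δ (μ ^ 72) (62 * m) (35092 * m)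
      (fun x y z => u (x + a) (y + b) (z + c)) := by
    refine ⟨hu.shift a b c (by omega) (by omega) (by omega),
      fun x y z hx hy hz => hcon x y z hx hy hz, ?_⟩
    obtain ⟨G, hGc, hG⟩ := hfew
    refine ⟨G.image (fun p => (p.1 - a, p.2.1 - b, p.2.2 - c)),
      le_trans (by exact_mod_cast Finset.card_image_le) hGc, ?_⟩
    intro x y z hx hy hz hm'
    refine hG _ _ _ ((abs_add_le _ _).trans (by omega))
      ((abs_add_le _ _).trans (by omega)) ((abs_add_le _ _).trans (by omega))
      fun hmem => hm' (Finset.mem_image.mpr ⟨_, hmem, by simp⟩)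
  have h1 := hd.cubeBound_iterate hμ1 hμ hμm hκ hδ0 (by omega) 35000 (by push_cast; omega)
    (-a) (-b) (-c) (by rw [abs_neg]; push_cast; omega) (by rw [abs_neg]; push_cast; omega)
    (by rw [abs_neg]; push_cast; omega)
  simp only [neg_add_cancel] at h1
  have h2 := growLoss_pow_lt (r := r) hκ hμ1 hμm (by omega)
  have h3 : 0 < |u 0 0 0| := abs_pos.mpr hu0
  rw [hδ, mul_comm _ (|u 0 0 0|), mul_assoc] at h1
  have h4 : exp (-(decayConst κ * (r : ℝ) ^ (3 / 2 : ℝ))) * growLoss κ μ m ^ 35000 < 1 := by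
    rw [exp_neg, inv_mul_lt_iff₀ (exp_pos _), mul_one]
    exact h2
  nlinarith

lemma pow_eq_rpow {m : ℕ} {μ : ℝ} (hμ : 0 ≤ μ) (hμm : μ ^ 40 = m) :
    μ ^ 72 = (m : ℝ) ^ (9 / 5 : ℝ) := by
  rw [← hμm, ← Real.rpow_natCast μ 40, ← Real.rpow_mul hμ, ← Real.rpow_natCast μ 72]
  norm_num

/-- The radius below which the trivial count is used. -/
def baseRadius : ℕ := 140000 * (58 ^ 14 + 1)

/-- The density constant in the count of large points. -/
noncomputable def densityConst : ℝ := 1 / (baseRadius : ℝ) ^ 2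

lemma rpow_le_sq {x : ℝ} (hx : 1 ≤ x) : x ^ (9 / 5 : ℝ) ≤ x ^ 2 := by
  rw [← Real.rpow_natCast x 2]
  exact Real.rpow_le_rpow_of_exponent_le hx (by norm_num)

lemma densityConst_pos : 0 < densityConst := by
  unfold densityConst baseRadius
  positivity

/-- On every cube of radius `r` the function `u` is not much smaller than at the centre on a set
of at least `c r ^ (9 / 5)` points. -/
lemma exists_many_large {κ : ℝ} (hκ : 0 ≤ κ) (r : ℕ) :
    ∀ u : ℤ → ℤ → ℤ → ℝ, NbrBound κ u r → ∃ F : Finset (ℤ × ℤ × ℤ),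
      LargeIn u r (exp (-(2 * decayConst κ * (r : ℝ) ^ (3 / 2 : ℝ))) * |u 0 0 0|) F ∧
      densityConst * (r : ℝ) ^ (9 / 5 : ℝ) ≤ F.card := by
  induction r using Nat.strong_induction_on with
  | _ r ih =>
  intro u hu
  have hC := decayConst_pos hκ
  have hc0 := densityConst_pos
  by_cases hr : r < baseRadius
  · refine ⟨{(0, 0, 0)}, ?_, ?_⟩
    · intro p hp
      rw [Finset.mem_singleton] at hp
      subst hp
      refine ⟨by simp, by simp, by simp, ?_⟩
      refine mul_le_of_le_one_left (abs_nonneg _) (exp_le_one_iff.mpr ?_)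
      have : 0 ≤ 2 * decayConst κ * (r : ℝ) ^ (3 / 2 : ℝ) := by positivity
      linarith
    · rw [Finset.card_singleton]
      rcases Nat.eq_zero_or_pos r with h0 | h0
      · subst h0
        simp
      · have h1 := rpow_le_sq (x := (r : ℝ)) (by exact_mod_cast h0)
        have h2 : (r : ℝ) ^ 2 ≤ (baseRadius : ℝ) ^ 2 := by
          have : (r : ℝ) ≤ baseRadius := by exact_mod_cast hr.le
          exact pow_le_pow_left₀ (by positivity) this 2
        have h3 : (0 : ℝ) < (baseRadius : ℝ) ^ 2 := by unfold baseRadius; positivity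
        unfold densityConst
        rw [one_div, inv_mul_le_iff₀ h3]
        push_cast
        linarith
  push Not at hr
  have hr1 : 1 ≤ r := le_trans (by unfold baseRadius; norm_num) hr
  have hr1R : (1 : ℝ) ≤ r := by exact_mod_cast hr1
  have hc1 : densityConst ≤ 1 / 280000 ^ 2 := by
    unfold densityConst
    have : (280000 : ℝ) ≤ baseRadius := by unfold baseRadius; norm_num
    gcongr
  by_cases hu0 : u 0 0 0 = 0
  · refine ⟨cubeFinset r, ?_, ?_⟩
    · intro p hp
      obtain ⟨h1, h2, h3⟩ := mem_cubeFinset.mp hp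
      exact ⟨h1, h2, h3, by simp [hu0]⟩
    · rw [card_cubeFinset]
      have h1 := rpow_le_sq hr1R
      push_cast
      have h2 : (r : ℝ) ^ 2 ≤ (2 * r + 1) ^ 3 := by nlinarith
      have h3 : (0 : ℝ) ≤ (r : ℝ) ^ (9 / 5 : ℝ) := by positivity
      nlinarith
  obtain ⟨m, hm⟩ : ∃ m, m = r / 140000 := ⟨_, rfl⟩
  have hmr : 140000 * m ≤ r := by omega
  have hm58 : 58 ^ 14 + 1 ≤ m := by
    rw [hm, Nat.le_div_iff_mul_le (by norm_num), mul_comm]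
    exact hr
  have hm1 : 1 ≤ m := by omega
  have hrm : r ≤ 280000 * m := by omega
  obtain ⟨μ, hμ⟩ : ∃ μ : ℝ, μ = (m : ℝ) ^ (1 / 40 : ℝ) := ⟨_, rfl⟩
  have hm1R : (1 : ℝ) ≤ m := by exact_mod_cast hm1
  have hμm : μ ^ 40 = m := by
    rw [hμ, ← Real.rpow_natCast, ← Real.rpow_mul (by positivity)]
    norm_num
  have hμ1 : 1 ≤ μ := by rw [hμ]; exact Real.one_le_rpow hm1R (by norm_num)
  have hμ3 : 58 ≤ μ ^ 3 := by
    by_contra! hlt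
    have h1 : (μ ^ 3) ^ 14 ≤ 58 ^ 14 := pow_le_pow_left₀ (by positivity) hlt.le 14
    have h2 : μ ^ 40 ≤ (μ ^ 3) ^ 14 := by
      rw [← pow_mul]
      exact pow_le_pow_right₀ hμ1 (by norm_num)
    have h3 : (58 : ℝ) ^ 14 + 1 ≤ m := by exact_mod_cast hm58
    linarith
  set δ := exp (-(decayConst κ * (r : ℝ) ^ (3 / 2 : ℝ))) * |u 0 0 0| with hδ
  have hδ0 : 0 ≤ δ := by positivity
  have hr32 : (0 : ℝ) ≤ (r : ℝ) ^ (3 / 2 : ℝ) := by positivity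
  by_cases hbig : densityConst * (r : ℝ) ^ (9 / 5 : ℝ) ≤
      ((cubeFinset r).filter (fun p => δ < |u p.1 p.2.1 p.2.2|)).card
  · refine ⟨_, ?_, hbig⟩
    intro p hp
    obtain ⟨hp1, hp2⟩ := Finset.mem_filter.mp hp
    obtain ⟨h1, h2, h3⟩ := mem_cubeFinset.mp hp1
    refine ⟨h1, h2, h3, le_trans ?_ hp2.le⟩
    rw [hδ]
    refine mul_le_mul_of_nonneg_right (exp_le_exp.mpr ?_) (abs_nonneg _)
    nlinarith
  push Not at hbig
  have hfew : FewLarge (μ ^ 72) δ u r := by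
    refine ⟨_, hbig.le.trans ?_, ?_⟩
    · rw [pow_eq_rpow (by linarith) hμm]
      have h1 : (r : ℝ) ^ (9 / 5 : ℝ) ≤ (280000 * (m : ℝ)) ^ (9 / 5 : ℝ) :=
        Real.rpow_le_rpow (by positivity) (by exact_mod_cast hrm) (by norm_num)
      rw [Real.mul_rpow (by norm_num) (by positivity)] at h1
      have h2 := rpow_le_sq (x := (280000 : ℝ)) (by norm_num)
      have h3 : (0 : ℝ) ≤ (m : ℝ) ^ (9 / 5 : ℝ) := by positivity
      calc densityConst * (r : ℝ) ^ (9 / 5 : ℝ)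
          ≤ 1 / 280000 ^ 2 * (280000 ^ 2 * (m : ℝ) ^ (9 / 5 : ℝ)) := by
            refine mul_le_mul hc1 (h1.trans (mul_le_mul_of_nonneg_right h2 h3))
              (by positivity) (by positivity)
        _ = _ := by ring
    · intro x y z hx hy hz hm'
      by_contra! hlt
      exact hm' (Finset.mem_filter.mpr ⟨mem_cubeFinset.mpr ⟨hx, hy, hz⟩, hlt⟩)
  obtain ⟨D, hD⟩ : ∃ D : ℕ, D = 140 := ⟨_, rfl⟩
  have hDZ : (D : ℤ) = 140 := by rw [hD]; rfl
  have hloc : ∀ q : ℤ × ℤ × ℤ, q ∈ cubeFinset D → ∃ F : Finset (ℤ × ℤ × ℤ),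
      densityConst * ((62 * m : ℕ) : ℝ) ^ (9 / 5 : ℝ) ≤ F.card ∧
      ∀ p ∈ F, (|p.1 - 250 * m * q.1| ≤ 124 * m ∧ |p.2.1 - 250 * m * q.2.1| ≤ 124 * m ∧
        |p.2.2 - 250 * m * q.2.2| ≤ 124 * m) ∧
        exp (-(2 * decayConst κ * (r : ℝ) ^ (3 / 2 : ℝ))) * |u 0 0 0| ≤ |u p.1 p.2.1 p.2.2| := by
    intro q hq
    obtain ⟨hq1, hq2, hq3⟩ := mem_cubeFinset.mp hq
    have habs : ∀ s : ℤ, |s| ≤ (D : ℤ) → |250 * m * s| ≤ 35000 * m := by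
      intro s hs
      rw [abs_mul, abs_of_nonneg (show (0 : ℤ) ≤ 250 * m by positivity)]
      rw [hDZ] at hs
      nlinarith
    have hb1 := habs _ hq1
    have hb2 := habs _ hq2
    have hb3 := habs _ hq3
    obtain ⟨x, y, z, hx, hy, hz, hlarge⟩ := exists_large_near hκ hμ1 hμ3 hμm hmr hu hu0 hδ hfew
      _ _ _ hb1 hb2 hb3
    have hx' := abs_add_le x (250 * m * q.1)
    have hy' := abs_add_le y (250 * m * q.2.1)
    have hz' := abs_add_le z (250 * m * q.2.2)
    obtain ⟨F, hF, hFc⟩ := ih (62 * m) (by omega) _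
      (hu.shift (R' := ((62 * m : ℕ) : ℤ)) (x + 250 * m * q.1) (y + 250 * m * q.2.1)
        (z + 250 * m * q.2.2) (by push_cast; omega) (by push_cast; omega) (by push_cast; omega))
    refine ⟨F.image (fun p => (p.1 + (x + 250 * m * q.1), p.2.1 + (y + 250 * m * q.2.1),
      p.2.2 + (z + 250 * m * q.2.2))), ?_, ?_⟩
    · rw [Finset.card_image_of_injective]
      · exact hFc
      · intro p p' hpp
        simp only [Prod.mk.injEq, add_left_inj] at hpp
        exact Prod.ext hpp.1 (Prod.ext hpp.2.1 hpp.2.2)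
    · intro p hp
      obtain ⟨p, hpF, rfl⟩ := Finset.mem_image.mp hp
      obtain ⟨h1, h2, h3, h4⟩ := hF p hpF
      push_cast at h1 h2 h3
      refine ⟨⟨?_, ?_, ?_⟩, ?_⟩
      · rw [show p.1 + (x + 250 * m * q.1) - 250 * m * q.1 = p.1 + x by ring]
        exact (abs_add_le _ _).trans (by omega)
      · rw [show p.2.1 + (y + 250 * m * q.2.1) - 250 * m * q.2.1 = p.2.1 + y by ring]
        exact (abs_add_le _ _).trans (by omega)
      · rw [show p.2.2 + (z + 250 * m * q.2.2) - 250 * m * q.2.2 = p.2.2 + z by ring]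
        exact (abs_add_le _ _).trans (by omega)
      · refine le_trans ?_ h4
        simp only [zero_add]
        have h5 : ((62 * m : ℕ) : ℝ) ^ (3 / 2 : ℝ) ≤ (r : ℝ) ^ (3 / 2 : ℝ) / 2 := by
          have h6 : ((62 * m : ℕ) : ℝ) * 2 ≤ r := by exact_mod_cast (by omega : 62 * m * 2 ≤ r)
          have h7 := Real.rpow_le_rpow (by positivity) h6 (show (0 : ℝ) ≤ 3 / 2 by norm_num)
          rw [Real.mul_rpow (by positivity) (by norm_num)] at h7
          have h8 : (2 : ℝ) ≤ 2 ^ (3 / 2 : ℝ) :=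
            Real.self_le_rpow_of_one_le (by norm_num) (by norm_num)
          have h9 : (0 : ℝ) ≤ ((62 * m : ℕ) : ℝ) ^ (3 / 2 : ℝ) := by positivity
          nlinarith
        calc exp (-(2 * decayConst κ * (r : ℝ) ^ (3 / 2 : ℝ))) * |u 0 0 0|
            ≤ exp (-(2 * decayConst κ * ((62 * m : ℕ) : ℝ) ^ (3 / 2 : ℝ))) * δ := by
              rw [hδ, ← mul_assoc, ← exp_add]
              refine mul_le_mul_of_nonneg_right (exp_le_exp.mpr ?_) (abs_nonneg _)
              nlinarith
          _ ≤ _ := mul_le_mul_of_nonneg_left hlarge.le (exp_pos _).le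
  choose! F hFc hF using hloc
  refine ⟨(cubeFinset D).biUnion F, ?_, ?_⟩
  · intro p hp
    obtain ⟨q, hq, hpq⟩ := Finset.mem_biUnion.mp hp
    obtain ⟨⟨h1, h2, h3⟩, h4⟩ := hF q hq p hpq
    obtain ⟨hq1, hq2, hq3⟩ := mem_cubeFinset.mp hq
    have habs : ∀ s t : ℤ, |s| ≤ (D : ℤ) → |t - 250 * m * s| ≤ 124 * m → |t| ≤ r := by
      intro s t hs ht
      rw [hDZ] at hs
      rw [abs_le] at hs ht ⊢
      constructor <;> nlinarith
    exact ⟨habs _ _ hq1 h1, habs _ _ hq2 h2, habs _ _ hq3 h3, h4⟩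
  · have hsep : ∀ s s' t : ℤ, |t - 250 * m * s| ≤ 124 * m → |t - 250 * m * s'| ≤ 124 * m →
        s = s' := by
      intro s s' t h1 h2
      rw [abs_le] at h1 h2
      have hm0 : (1 : ℤ) ≤ m := by exact_mod_cast hm1
      rcases lt_trichotomy s s' with h | h | h
      · nlinarith
      · exact h
      · nlinarith
    rw [Finset.card_biUnion]
    · push_cast
      have h1 : ∑ q ∈ cubeFinset D, densityConst * ((62 * m : ℕ) : ℝ) ^ (9 / 5 : ℝ) ≤
          ∑ q ∈ cubeFinset D, ((F q).card : ℝ) := Finset.sum_le_sum fun q hq => hFc q hq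
      refine le_trans ?_ h1
      rw [Finset.sum_const, card_cubeFinset, nsmul_eq_mul, hD]
      have h2 : (r : ℝ) ^ (9 / 5 : ℝ) ≤ (4517 * ((62 * m : ℕ) : ℝ)) ^ (9 / 5 : ℝ) :=
        Real.rpow_le_rpow (by positivity) (by exact_mod_cast (by omega : r ≤ 4517 * (62 * m)))
          (by norm_num)
      rw [Real.mul_rpow (by norm_num) (by positivity)] at h2
      have h3 := rpow_le_sq (x := (4517 : ℝ)) (by norm_num)
      have h4 : (0 : ℝ) ≤ ((62 * m : ℕ) : ℝ) ^ (9 / 5 : ℝ) := by positivity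
      have h5 : (r : ℝ) ^ (9 / 5 : ℝ) ≤ 281 ^ 3 * ((62 * m : ℕ) : ℝ) ^ (9 / 5 : ℝ) := by
        nlinarith
      have h6 := mul_le_mul_of_nonneg_left h5 hc0.le
      norm_num at h6 ⊢
      linarith
    · intro q hq q' hq' hne
      refine Finset.disjoint_left.mpr fun p hp hp' => hne ?_
      obtain ⟨⟨h1, h2, h3⟩, _⟩ := hF q hq p hp
      obtain ⟨⟨h1', h2', h3'⟩, _⟩ := hF q' hq' p hp'
      exact Prod.ext (hsep _ _ _ h1 h1') (Prod.ext (hsep _ _ _ h2 h2') (hsep _ _ _ h3 h3'))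

lemma NbrBound.exists_large_at_height {κ : ℝ} {u : ℤ → ℤ → ℤ → ℝ} {R : ℤ} (hκ : 0 ≤ κ)
    (hu : NbrBound κ u R) (k : ℕ) (hk : (k : ℤ) ≤ R) :
    ∃ x y z : ℤ, |x| ≤ k ∧ |y| ≤ k ∧ (k : ℤ) ≤ z ∧ z ≤ k + 1 ∧
      |u 0 0 0| ≤ (κ + 5) ^ k * |u x y z| := by
  induction k with
  | zero => exact ⟨0, 0, 0, by simp, by simp, by simp, by simp, by simp⟩
  | succ k ih =>
    push_cast at hk
    obtain ⟨x, y, z, hx, hy, hz1, hz2, h⟩ := ih (by omega)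
    have hpow : (0 : ℝ) < (κ + 5) ^ k := by positivity
    suffices hs : ∃ x' y' z' : ℤ, |x'| ≤ k + 1 ∧ |y'| ≤ k + 1 ∧ (k : ℤ) + 1 ≤ z' ∧
        z' ≤ k + 1 + 1 ∧ |u x y z| ≤ (κ + 5) * |u x' y' z'| by
      obtain ⟨x', y', z', h1, h2, h3, h4, h5⟩ := hs
      refine ⟨x', y', z', by push_cast; exact h1, by push_cast; exact h2, by push_cast; exact h3,
        by push_cast; exact h4, h.trans ?_⟩
      rw [pow_succ, mul_assoc]
      exact mul_le_mul_of_nonneg_left h5 hpow.le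
    rcases eq_or_lt_of_le hz1 with hz | hz
    · subst hz
      by_contra! hcon
      have hx2 := abs_le.mp hx
      have hy2 := abs_le.mp hy
      have hb := hu x y (k + 1) (by omega) (by omega) (by rw [abs_of_nonneg] <;> omega)
      have e0 := hcon x y (k + 1) (by omega) (by omega) (by omega) (by omega)
      have e1 := hcon (x + 1) y (k + 1) (by rw [abs_le]; omega) (by omega) (by omega) (by omega)
      have e2 := hcon (x - 1) y (k + 1) (by rw [abs_le]; omega) (by omega) (by omega) (by omega)
      have e3 := hcon x (y + 1) (k + 1) (by omega) (by rw [abs_le]; omega) (by omega) (by omega)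
      have e4 := hcon x (y - 1) (k + 1) (by omega) (by rw [abs_le]; omega) (by omega) (by omega)
      have e5 := hcon x y (k + 1 + 1) (by omega) (by omega) (by omega) (by omega)
      simp only [nbrSum, add_sub_cancel_right] at hb
      set s := |u x y k| with hs
      have hsum : s ≤ κ * |u x y (k + 1)| + (|u (x + 1) y (k + 1)| + |u (x - 1) y (k + 1)| +
          |u x (y + 1) (k + 1)| + |u x (y - 1) (k + 1)| + |u x y (k + 1 + 1)|) := by
        have a1 := abs_le.mp hb
        have b1 := abs_le.mp (le_refl |u (x + 1) y (k + 1)|)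
        have b2 := abs_le.mp (le_refl |u (x - 1) y (k + 1)|)
        have b3 := abs_le.mp (le_refl |u x (y + 1) (k + 1)|)
        have b4 := abs_le.mp (le_refl |u x (y - 1) (k + 1)|)
        have b5 := abs_le.mp (le_refl |u x y (k + 1 + 1)|)
        rw [hs, abs_le]
        constructor <;> linarith
      have hκ0 := mul_le_mul_of_nonneg_left e0.le hκ
      nlinarith
    · refine ⟨x, y, z, by omega, by omega, by omega, by omega, ?_⟩
      nlinarith [abs_nonneg (u x y z)]

lemma exists_many_large_of_height {κ : ℝ} (hκ : 0 ≤ κ) {n r k : ℕ} {u : ℤ → ℤ → ℤ → ℝ}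
    (hu : NbrBound κ u n) (hr : (r : ℝ) ^ (3 / 2 : ℝ) ≤ n) (hk : k + r + 1 ≤ n) :
    ∃ F : Finset (ℤ × ℤ × ℤ),
      LargeIn u n (exp (-(2 * decayConst κ + Real.log (κ + 5)) * n) * |u 0 0 0|) F ∧
      densityConst * (r : ℝ) ^ (9 / 5 : ℝ) ≤ F.card ∧
      ∀ p ∈ F, (k : ℤ) - r ≤ p.2.2 ∧ p.2.2 ≤ k + r + 1 := by
  obtain ⟨x, y, z, hx, hy, hz1, hz2, h⟩ := hu.exists_large_at_height hκ k (by omega)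
  have hz : |z| ≤ k + 1 := abs_le.mpr ⟨by omega, by omega⟩
  obtain ⟨F, hF, hFc⟩ := exists_many_large hκ r _
    (hu.shift (R' := (r : ℤ)) x y z (by omega) (by omega) (by omega))
  refine ⟨F.image (fun p => (p.1 + x, p.2.1 + y, p.2.2 + z)), ?_, ?_, ?_⟩
  · intro p hp
    obtain ⟨p, hpF, rfl⟩ := Finset.mem_image.mp hp
    obtain ⟨h1, h2, h3, h4⟩ := hF p hpF
    refine ⟨(abs_add_le _ _).trans (by omega), (abs_add_le _ _).trans (by omega),
      (abs_add_le _ _).trans (by omega), le_trans ?_ h4⟩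
    simp only [zero_add]
    have hlog : 0 ≤ Real.log (κ + 5) := Real.log_nonneg (by linarith)
    have hC := decayConst_pos hκ
    have hkn : (k : ℝ) ≤ n := by exact_mod_cast (by omega : k ≤ n)
    have hpow : (κ + 5) ^ k ≤ exp (Real.log (κ + 5) * n) := by
      rw [← exp_log (show 0 < (κ + 5) ^ k by positivity), Real.log_pow]
      refine exp_le_exp.mpr ?_
      nlinarith
    calc exp (-(2 * decayConst κ + Real.log (κ + 5)) * n) * |u 0 0 0|
        ≤ exp (-(2 * decayConst κ + Real.log (κ + 5)) * n) *
            (exp (Real.log (κ + 5) * n) * |u x y z|) :=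
          mul_le_mul_of_nonneg_left
            (h.trans (mul_le_mul_of_nonneg_right hpow (abs_nonneg _))) (exp_pos _).le
      _ = exp (-(2 * decayConst κ * n)) * |u x y z| := by
          rw [← mul_assoc, ← exp_add]
          congr 2
          ring
      _ ≤ _ := by
          refine mul_le_mul_of_nonneg_right (exp_le_exp.mpr ?_) (abs_nonneg _)
          nlinarith
  · rw [Finset.card_image_of_injective]
    · exact hFc
    · intro p p' hpp
      simp only [Prod.mk.injEq, add_left_inj] at hpp
      exact Prod.ext hpp.1 (Prod.ext hpp.2.1 hpp.2.2)
  · intro p hp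
    obtain ⟨p, hpF, rfl⟩ := Finset.mem_image.mp hp
    obtain ⟨-, -, h3, -⟩ := hF p hpF
    rw [abs_le] at h3
    constructor <;> simp only <;> omega

/-- Stacking cubes of radius about `n ^ (2 / 3)` along a coordinate axis. -/
lemma exists_many_large_stacked {κ : ℝ} (hκ : 0 ≤ κ) {n : ℕ} (hn : 1000 ≤ n)
    {u : ℤ → ℤ → ℤ → ℝ} (hu : NbrBound κ u n) :
    ∃ F : Finset (ℤ × ℤ × ℤ),
      LargeIn u n (exp (-(2 * decayConst κ + Real.log (κ + 5)) * n) * |u 0 0 0|) F ∧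
      densityConst / 32 * (n : ℝ) ^ (23 / 15 : ℝ) ≤ F.card := by
  have hc0 := densityConst_pos
  have hn1 : (1 : ℝ) ≤ n := by exact_mod_cast (by omega : 1 ≤ n)
  have hn23 : (1 : ℝ) ≤ (n : ℝ) ^ (2 / 3 : ℝ) := Real.one_le_rpow hn1 (by norm_num)
  obtain ⟨r, hr⟩ : ∃ r : ℕ, r = ⌊(n : ℝ) ^ (2 / 3 : ℝ)⌋₊ := ⟨_, rfl⟩
  have hr1 : 1 ≤ r := by rw [hr]; exact Nat.le_floor (by exact_mod_cast hn23)
  have hr1R : (1 : ℝ) ≤ r := by exact_mod_cast hr1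
  have hrle : (r : ℝ) ≤ (n : ℝ) ^ (2 / 3 : ℝ) := by
    rw [hr]; exact Nat.floor_le (by positivity)
  have hrge : (n : ℝ) ^ (2 / 3 : ℝ) ≤ 2 * r := by
    have := Nat.lt_floor_add_one ((n : ℝ) ^ (2 / 3 : ℝ))
    rw [← hr] at this
    linarith
  have hr32 : (r : ℝ) ^ (3 / 2 : ℝ) ≤ n := by
    have := Real.rpow_le_rpow (by positivity) hrle (show (0 : ℝ) ≤ 3 / 2 by norm_num)
    rw [← Real.rpow_mul (by positivity)] at this
    norm_num at this
    exact this
  have h8r : 8 * r ≤ n := by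
    have h1 : (n : ℝ) ^ (2 / 3 : ℝ) * (n : ℝ) ^ (1 / 3 : ℝ) = n := by
      rw [← Real.rpow_add (by linarith)]
      norm_num
    have h2 : (10 : ℝ) ≤ (n : ℝ) ^ (1 / 3 : ℝ) := by
      have h3 : ((10 : ℝ) ^ (3 : ℝ)) ^ (1 / 3 : ℝ) = 10 := by
        rw [← Real.rpow_mul (by norm_num)]
        norm_num
      rw [← h3]
      refine Real.rpow_le_rpow (by positivity) ?_ (by norm_num)
      norm_num
      exact_mod_cast hn
    have h3 : (8 : ℝ) * r ≤ n := by nlinarith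
    exact_mod_cast h3
  obtain ⟨L, hL⟩ : ∃ L : ℕ, L = n / (8 * r) := ⟨_, rfl⟩
  have hL1 : 1 ≤ L := by rw [hL]; exact (Nat.one_le_div_iff (by omega)).mpr h8r
  have hLn : L * (8 * r) ≤ n := by rw [hL]; exact Nat.div_mul_le_self _ _
  have hnL : n ≤ 2 * L * (8 * r) := by
    have h1 := Nat.lt_div_mul_add (a := n) (b := 8 * r) (by omega)
    rw [← hL] at h1
    nlinarith
  have hloc : ∀ i ∈ Finset.range L, ∃ F : Finset (ℤ × ℤ × ℤ),
      LargeIn u n (exp (-(2 * decayConst κ + Real.log (κ + 5)) * n) * |u 0 0 0|) F ∧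
      densityConst * (r : ℝ) ^ (9 / 5 : ℝ) ≤ F.card ∧
      ∀ p ∈ F, ((4 * r * i : ℕ) : ℤ) - r ≤ p.2.2 ∧ p.2.2 ≤ (4 * r * i : ℕ) + r + 1 := by
    intro i hi
    rw [Finset.mem_range] at hi
    refine exists_many_large_of_height hκ hu hr32 ?_
    nlinarith
  choose! F hF hFc hFz using hloc
  refine ⟨(Finset.range L).biUnion F, ?_, ?_⟩
  · intro p hp
    obtain ⟨i, hi, hpi⟩ := Finset.mem_biUnion.mp hp
    exact hF i hi p hpi
  · rw [Finset.card_biUnion]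
    · push_cast
      have h1 : ∑ i ∈ Finset.range L, densityConst * (r : ℝ) ^ (9 / 5 : ℝ) ≤
          ∑ i ∈ Finset.range L, ((F i).card : ℝ) := Finset.sum_le_sum fun i hi => hFc i hi
      refine le_trans ?_ h1
      rw [Finset.sum_const, Finset.card_range, nsmul_eq_mul]
      have h2 : (n : ℝ) ^ (8 / 15 : ℝ) ≤ 2 * (r : ℝ) ^ (4 / 5 : ℝ) := by
        have h3 := Real.rpow_le_rpow (by positivity) hrge (show (0 : ℝ) ≤ 4 / 5 by norm_num)
        rw [← Real.rpow_mul (by positivity), Real.mul_rpow (by norm_num) (by positivity)] at h3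
        have h4 : (2 : ℝ) ^ (4 / 5 : ℝ) ≤ 2 ^ (1 : ℝ) :=
          Real.rpow_le_rpow_of_exponent_le (by norm_num) (by norm_num)
        rw [Real.rpow_one] at h4
        have h5 : (0 : ℝ) ≤ (r : ℝ) ^ (4 / 5 : ℝ) := by positivity
        norm_num at h3
        nlinarith
      have h3 : (r : ℝ) ^ (9 / 5 : ℝ) = r * (r : ℝ) ^ (4 / 5 : ℝ) := by
        rw [← Real.rpow_one_add' (by positivity) (by norm_num)]
        norm_num
      have h4 : (n : ℝ) ^ (23 / 15 : ℝ) = n * (n : ℝ) ^ (8 / 15 : ℝ) := by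
        rw [← Real.rpow_one_add' (by positivity) (by norm_num)]
        norm_num
      have h5 : (n : ℝ) ≤ 2 * L * (8 * r) := by exact_mod_cast hnL
      have h6 : (n : ℝ) * (n : ℝ) ^ (8 / 15 : ℝ) ≤
          2 * L * (8 * r) * (2 * (r : ℝ) ^ (4 / 5 : ℝ)) :=
        mul_le_mul h5 h2 (by positivity) (by positivity)
      rw [h3, h4]
      have h7 := mul_le_mul_of_nonneg_left h6 (show 0 ≤ densityConst / 32 by positivity)
      refine h7.trans (le_of_eq ?_)
      ring
    · have hsep : ∀ i j : ℕ, i < j → i ∈ Finset.range L → j ∈ Finset.range L →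
          Disjoint (F i) (F j) := by
        intro i j hij hi hj
        refine Finset.disjoint_left.mpr fun p hp hp' => ?_
        have h1 := (hFz i hi p hp).2
        have h2 := (hFz j hj p hp').1
        have h3 : 4 * r * (i + 1) ≤ 4 * r * j := Nat.mul_le_mul_left _ hij
        rw [mul_add, mul_one] at h3
        omega
      intro i hi j hj hne
      rcases lt_or_gt_of_ne hne with h | h
      · exact hsep i j h hi hj
      · exact (hsep j i h hj hi).symm

/-- Coordinates on triples. -/
def tripleVec (p : ℤ × ℤ × ℤ) : Fin 3 → ℤ := ![p.1, p.2.1, p.2.2]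

lemma tripleVec_injective : Function.Injective tripleVec := by
  intro p p' h
  have h0 := congrFun h 0
  have h1 := congrFun h 1
  have h2 := congrFun h 2
  simp [tripleVec] at h0 h1 h2
  exact Prod.ext h0 (Prod.ext h1 h2)

lemma tripleVec_mem_latticeCube {r : ℕ} {p : ℤ × ℤ × ℤ} (h0 : |p.1| ≤ (r : ℤ))
    (h1 : |p.2.1| ≤ (r : ℤ)) (h2 : |p.2.2| ≤ (r : ℤ)) : tripleVec p ∈ latticeCube r := by
  intro i
  fin_cases i <;> simpa [tripleVec]

lemma finite_latticeCube (r : ℕ) : (latticeCube r).Finite := by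
  refine (Set.finite_Icc (fun _ : Fin 3 => -(r : ℤ)) (fun _ => (r : ℤ))).subset ?_
  intro a ha
  exact ⟨fun i => (abs_le.mp (ha i)).1, fun i => (abs_le.mp (ha i)).2⟩

lemma discreteLaplacian3_tripleVec (u : (Fin 3 → ℤ) → ℝ) (x y z : ℤ) :
    discreteLaplacian3 u (tripleVec (x, y, z)) =
      nbrSum (fun x y z => u (tripleVec (x, y, z))) x y z - 6 * u (tripleVec (x, y, z)) := by
  have h0 : ∀ t, Function.update (tripleVec (x, y, z)) 0 t = tripleVec (t, y, z) := by
    intro t; ext i; fin_cases i <;> simp [tripleVec]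
  have h1 : ∀ t, Function.update (tripleVec (x, y, z)) 1 t = tripleVec (x, t, z) := by
    intro t; ext i; fin_cases i <;> simp [tripleVec]
  have h2 : ∀ t, Function.update (tripleVec (x, y, z)) 2 t = tripleVec (x, y, t) := by
    intro t; ext i; fin_cases i <;> simp [tripleVec]
  have e0 : tripleVec (x, y, z) 0 = x := rfl
  have e1 : tripleVec (x, y, z) 1 = y := rfl
  have e2 : tripleVec (x, y, z) 2 = z := rfl
  simp only [discreteLaplacian3, Fin.sum_univ_three, h0, h1, h2, e0, e1, e2, nbrSum]
  ring

lemma nbrBound_of_eigen {K : ℝ} {n : ℕ} {u q : (Fin 3 → ℤ) → ℝ}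
    (hu : ∀ x ∈ latticeCube n, discreteLaplacian3 u x = q x * u x) (hq : ∀ x, |q x| ≤ K) :
    NbrBound (K + 6) (fun x y z => u (tripleVec (x, y, z))) n := by
  intro x y z hx hy hz
  have h := hu _ (tripleVec_mem_latticeCube (p := (x, y, z)) hx hy hz)
  rw [discreteLaplacian3_tripleVec] at h
  rw [show nbrSum (fun x y z => u (tripleVec (x, y, z))) x y z =
    (q (tripleVec (x, y, z)) + 6) * u (tripleVec (x, y, z)) by linarith, abs_mul]
  refine mul_le_mul_of_nonneg_right ((abs_add_le _ _).trans ?_) (abs_nonneg _)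
  rw [abs_of_pos (by norm_num : (0 : ℝ) < 6)]
  linarith [hq (tripleVec (x, y, z))]

/-- **Li–Zhang's deterministic quantitative unique continuation theorem on `ℤ³`**
(Theorem 1.3 of Li–Zhang, 2022). There is `p > 3/2` such that for each `K > 0` there is
`C₁ > 0` so that for all large enough `n` and all `u, q : ℤ³ → ℝ` with `Δ_d u = q u` in
`Q_n` and `‖q‖_∞ ≤ K`, `#{a ∈ Q_n : |u(a)| ≥ e^{−C₁ n} |u(0)|} ≥ n^p`. -/
theorem li_zhang_lattice_ucp :
    ∃ p : ℝ, 3 / 2 < p ∧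
      ∀ K : ℝ, 0 < K → ∃ C₁ : ℝ, 0 < C₁ ∧ ∃ N : ℕ, ∀ n : ℕ, N ≤ n →
        ∀ u q : (Fin 3 → ℤ) → ℝ,
          (∀ x ∈ latticeCube n, discreteLaplacian3 u x = q x * u x) →
          (∀ x, |q x| ≤ K) →
          (n : ℝ) ^ p ≤
            (({a ∈ latticeCube n |
                Real.exp (-C₁ * n) * |u 0| ≤ |u a|}).ncard : ℝ) := by
  refine ⟨38 / 25, by norm_num, fun K hK => ?_⟩
  have hκ : 0 ≤ K + 6 := by linarith
  have hC := decayConst_pos hκ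
  have hc := densityConst_pos
  have hlog : 0 ≤ Real.log (K + 6 + 5) := Real.log_nonneg (by linarith)
  refine ⟨2 * decayConst (K + 6) + Real.log (K + 6 + 5), by positivity,
    max 1000 ⌈(32 / densityConst) ^ (75 : ℕ)⌉₊, fun n hn u q hu hq => ?_⟩
  obtain ⟨F, hF, hFc⟩ := exists_many_large_stacked hκ (le_trans (le_max_left _ _) hn)
    (nbrBound_of_eigen hu hq)
  have hn1 : 1000 ≤ n := le_trans (le_max_left _ _) hn
  have hn0 : (0 : ℝ) < n := by exact_mod_cast (by omega : 0 < n)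
  have hroot : 32 / densityConst ≤ (n : ℝ) ^ (1 / 75 : ℝ) := by
    have h1 : (32 / densityConst) ^ (75 : ℕ) ≤ n :=
      (Nat.le_ceil _).trans (by exact_mod_cast (le_max_right _ _).trans hn)
    have h2 := Real.rpow_le_rpow (by positivity) h1 (show (0 : ℝ) ≤ 1 / 75 by norm_num)
    rw [← Real.rpow_natCast, ← Real.rpow_mul (by positivity)] at h2
    norm_num at h2 ⊢
    exact h2
  have hexp : (n : ℝ) ^ (38 / 25 : ℝ) ≤ densityConst / 32 * (n : ℝ) ^ (23 / 15 : ℝ) := by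
    have h1 : (n : ℝ) ^ (23 / 15 : ℝ) = (n : ℝ) ^ (38 / 25 : ℝ) * (n : ℝ) ^ (1 / 75 : ℝ) := by
      rw [← Real.rpow_add hn0]
      norm_num
    have h2 : 1 ≤ densityConst / 32 * (n : ℝ) ^ (1 / 75 : ℝ) := by
      rw [div_le_iff₀ hc] at hroot
      linarith
    have h3 : (0 : ℝ) ≤ (n : ℝ) ^ (38 / 25 : ℝ) := by positivity
    rw [h1]
    nlinarith
  refine hexp.trans (hFc.trans ?_)
  rw [← Finset.card_image_of_injective F tripleVec_injective, ← Set.ncard_coe_finset]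
  have hsub : ((F.image tripleVec : Finset (Fin 3 → ℤ)) : Set (Fin 3 → ℤ)) ⊆
      {a ∈ latticeCube n | Real.exp (-(2 * decayConst (K + 6) + Real.log (K + 6 + 5)) * n) *
        |u 0| ≤ |u a|} := by
    intro a ha
    obtain ⟨p, hp, rfl⟩ := Finset.mem_image.mp (Finset.mem_coe.mp ha)
    obtain ⟨h1, h2, h3, h4⟩ := hF p hp
    have h0 : tripleVec (0, 0, 0) = 0 := by ext i; fin_cases i <;> rfl
    rw [h0] at h4
    exact ⟨tripleVec_mem_latticeCube h1 h2 h3, h4⟩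
  exact_mod_cast Set.ncard_le_ncard hsub ((finite_latticeCube n).subset (Set.sep_subset _ _))
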